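/- arXiv:0911.0145 — 13 statements merged into one kernel-verified Lean document; each statement's English description precedes it below -/
import Mathlib

section
/- There exists a topological space X which is Hausdorff, regular, zero-dimensional (has a base of clopen sets), is a P-space, has cardinality ℵ₁, and is not Whyburn. -/
open Cardinal Set TopologicalSpace

/-- A P-space: the intersection of every countable family of open sets is open. -/
def IsPSpace (X : Type*) [TopologicalSpace X] : Prop :=
  ∀ S : Set (Set X), S.Countable → (∀ s ∈ S, IsOpen s) → IsOpen (⋂₀ S)

/-- Whyburn: for every non-closed `A` and every `x ∈ closure A \ A` there is an
almost closed `F ⊆ A` converging to `x`. -/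
def IsWhyburn (X : Type*) [TopologicalSpace X] : Prop :=
  ∀ A : Set X, ¬ IsClosed A → ∀ x ∈ closure A \ A, ∃ F ⊆ A, closure F \ F = {x}

/-- Weakly Whyburn: for every non-closed `A` there are `x ∈ closure A \ A` and an
almost closed `F ⊆ A` converging to `x`. -/
def IsWeaklyWhyburn (X : Type*) [TopologicalSpace X] : Prop :=
  ∀ A : Set X, ¬ IsClosed A → ∃ x ∈ closure A \ A, ∃ F ⊆ A, closure F \ F = {x}

/-- The points of the `ℵ₁`-analogue of the Arens space over an index type `I`. -/
inductive ArensPoint (I : Type) : Type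
  /-- The apex. -/
  | apex : ArensPoint I
  /-- The limit of the column `a`. -/
  | lim (a : I) : ArensPoint I
  /-- The isolated points of the column `a`. -/
  | pt (a b : I) : ArensPoint I

namespace ArensPoint

variable {I : Type}

/-- A set is open if it contains all but countably many column limits whenever it contains the
apex, and all but countably many points of a column whenever it contains its limit. -/
def Open (U : Set (ArensPoint I)) : Prop :=
  (apex ∈ U → {a | lim a ∉ U}.Countable) ∧ ∀ a, lim a ∈ U → {b | pt a b ∉ U}.Countable

theorem open_sInter {S : Set (Set (ArensPoint I))} (hS : S.Countable) (h : ∀ s ∈ S, Open s) :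
    Open (⋂₀ S) := by
  refine ⟨fun hx => ?_, fun a hx => ?_⟩
  · refine (hS.biUnion fun s hs => (h s hs).1 (hx s hs)).mono fun a ha => ?_
    simpa using ha
  · refine (hS.biUnion fun s hs => (h s hs).2 a (hx s hs)).mono fun b hb => ?_
    simpa using hb

instance : TopologicalSpace (ArensPoint I) where
  IsOpen := Open
  isOpen_univ := by simp [Open]
  isOpen_inter s t hs ht := by
    rw [← sInter_pair]
    exact open_sInter (by simp) (by simp [hs, ht])
  isOpen_sUnion S h := by
    refine ⟨?_, ?_⟩
    · rintro ⟨s, hs, hx⟩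
      exact ((h s hs).1 hx).mono fun a ha hmem => ha ⟨s, hs, hmem⟩
    · rintro a ⟨s, hs, hx⟩
      exact ((h s hs).2 a hx).mono fun b hb hmem => hb ⟨s, hs, hmem⟩

theorem isOpen_def {U : Set (ArensPoint I)} : IsOpen U ↔
    (apex ∈ U → {a | lim a ∉ U}.Countable) ∧ ∀ a, lim a ∈ U → {b | pt a b ∉ U}.Countable :=
  Iff.rfl

theorem isPSpace : IsPSpace (ArensPoint I) := fun _ hS h => open_sInter hS h

instance : T1Space (ArensPoint I) where
  t1 x := by
    rw [← isOpen_compl_iff, isOpen_def]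
    refine ⟨fun _ => Set.Subsingleton.countable ?_, fun a _ => Set.Subsingleton.countable ?_⟩
    · intro a ha b hb
      simpa using (not_not.1 ha).trans (not_not.1 hb).symm
    · intro b hb c hc
      simpa using (not_not.1 hb).trans (not_not.1 hc).symm

theorem exists_isClopen_subset {U : Set (ArensPoint I)} (hU : IsOpen U) (x : ArensPoint I)
    (hx : x ∈ U) : ∃ V, IsClopen V ∧ x ∈ V ∧ V ⊆ U := by
  cases x with
  | apex =>
    refine ⟨{y | y = apex ∨ (∃ a, y = lim a ∧ lim a ∈ U) ∨
      ∃ a b, y = pt a b ∧ lim a ∈ U ∧ pt a b ∈ U}, ⟨?_, ?_⟩, by simp, ?_⟩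
    · rw [← isOpen_compl_iff, isOpen_def]
      refine ⟨by simp, fun a ha => ?_⟩
      have ha : lim a ∉ U := by simpa using ha
      convert Set.countable_empty using 1
      ext b
      simp [ha]
    · rw [isOpen_def]
      refine ⟨fun _ => by simpa using hU.1 hx, fun a ha => ?_⟩
      have ha : lim a ∈ U := by simpa using ha
      simpa [ha] using hU.2 a ha
    · rintro y (rfl | ⟨a, rfl, h⟩ | ⟨a, b, rfl, -, h⟩) <;> assumption
  | lim a =>
    refine ⟨{y | y = lim a ∨ ∃ b, y = pt a b ∧ pt a b ∈ U}, ⟨?_, ?_⟩, by simp, ?_⟩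
    · rw [← isOpen_compl_iff, isOpen_def]
      refine ⟨fun _ => by simp, fun c hc => ?_⟩
      have hc : c ≠ a := by simpa using hc
      convert Set.countable_empty using 1
      ext b
      simp [hc]
    · rw [isOpen_def]
      refine ⟨by simp, fun c hc => ?_⟩
      obtain rfl : c = a := by simpa using hc
      simpa using hU.2 c hx
    · rintro y (rfl | ⟨b, rfl, h⟩) <;> assumption
  | pt a b =>
    refine ⟨{pt a b}, ⟨isClosed_singleton, ?_⟩, rfl, by simpa using hx⟩
    rw [isOpen_def]
    simp

theorem isTopologicalBasis_isClopen :
    IsTopologicalBasis {s : Set (ArensPoint I) | IsClopen s} := by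
  refine isTopologicalBasis_of_isOpen_of_nhds (fun s hs => hs.isOpen) fun x U hx hU => ?_
  obtain ⟨V, hV, hxV, hVU⟩ := exists_isClopen_subset hU x hx
  exact ⟨V, hV, hxV, hVU⟩

instance : RegularSpace (ArensPoint I) :=
  .of_exists_mem_nhds_isClosed_subset fun x s hs => by
    obtain ⟨U, hUs, hU, hx⟩ := mem_nhds_iff.1 hs
    obtain ⟨V, hV, hxV, hVU⟩ := exists_isClopen_subset hU x hx
    exact ⟨V, hV.isOpen.mem_nhds hxV, hV.isClosed, hVU.trans hUs⟩

/-- If a set meets uncountably many points of a column, the column limit is in its closure. -/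
theorem lim_mem_closure {F : Set (ArensPoint I)} {a : I} (h : ¬ {b | pt a b ∈ F}.Countable) :
    lim a ∈ closure F := by
  by_contra hcl
  have := (isOpen_def.1 (isClosed_closure (s := F)).isOpen_compl).2 a hcl
  exact h (this.mono fun b hb => not_not.2 (subset_closure (s := F) hb))

/-- A set of isolated points with the apex in its closure meets some column uncountably often. -/
theorem exists_uncountable_column {F : Set (ArensPoint I)} (hF : F ⊆ {y | ∃ a b, y = pt a b})
    (h : apex ∈ closure F) : ∃ a, ¬ {b | pt a b ∈ F}.Countable := by
  by_contra! hc
  have hl : ∀ a, lim a ∉ F := fun a ha => by simpa using hF ha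
  have hclosed : IsClosed F := by
    rw [← isOpen_compl_iff, isOpen_def]
    exact ⟨fun _ => by simp [hl], fun a _ => by simpa using hc a⟩
  rw [hclosed.closure_eq] at h
  simpa using hF h

theorem not_isWhyburn [Uncountable I] : ¬ IsWhyburn (ArensPoint I) := by
  intro hW
  set A : Set (ArensPoint I) := {y | ∃ a b, y = pt a b} with hA
  have hlim : ∀ a, lim a ∈ closure A := fun a => lim_mem_closure <| by
    simpa [hA] using Set.not_countable_univ
  have hapex : apex ∈ closure A := by
    by_contra hcl
    have := (isOpen_def.1 (isClosed_closure (s := A)).isOpen_compl).1 hcl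
    exact Set.not_countable_univ (this.mono fun a _ => not_not.2 (hlim a))
  have hnot : apex ∉ A := by simp [hA]
  obtain ⟨F, hFA, hF⟩ :=
    hW A (fun h => hnot (h.closure_eq ▸ hapex)) apex ⟨hapex, hnot⟩
  have hmem : apex ∈ closure F \ F := hF ▸ rfl
  obtain ⟨a, ha⟩ := exists_uncountable_column hFA hmem.1
  have : lim a ∈ closure F \ F :=
    ⟨lim_mem_closure ha, fun h => by simpa [hA] using hFA h⟩
  rw [hF] at this
  simp at this

/-- A point is the apex, or a column with either its limit or one of its isolated points. -/
def equivOption : ArensPoint I ≃ Option (I × Option I) where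
  toFun
    | apex => none
    | lim a => some (a, none)
    | pt a b => some (a, some b)
  invFun
    | none => apex
    | some (a, none) => lim a
    | some (a, some b) => pt a b
  left_inv := by rintro (_ | _ | _) <;> rfl
  right_inv := by rintro (_ | ⟨_, _ | _⟩) <;> rfl

theorem mk_eq [Infinite I] : #(ArensPoint I) = #I := by
  rw [Cardinal.mk_congr equivOption]
  simp [Cardinal.mk_option]

end ArensPoint

/-- There exists a Hausdorff, regular, zero-dimensional P-space of cardinality ℵ₁
which is not Whyburn. -/
theorem statement0 :
    ∃ (X : Type) (_ : TopologicalSpace X),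
      T2Space X ∧ RegularSpace X ∧
      (∃ B : Set (Set X), IsTopologicalBasis B ∧ ∀ s ∈ B, IsClopen s) ∧
      IsPSpace X ∧ Cardinal.mk X = Cardinal.aleph 1 ∧ ¬ IsWhyburn X := by
  have hI : #(aleph 1).out = aleph 1 := mk_out _
  have : Uncountable (aleph 1).out := by
    rw [← Cardinal.aleph0_lt_mk_iff, hI]
    exact Cardinal.aleph0_lt_aleph_one
  exact ⟨ArensPoint (aleph 1).out, inferInstance, inferInstance, inferInstance,
    ⟨_, ArensPoint.isTopologicalBasis_isClopen, fun _ h => h⟩, ArensPoint.isPSpace,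
    ArensPoint.mk_eq.trans hI, ArensPoint.not_isWhyburn⟩
end

section
/- There exists a topological space X which is completely regular (Tychonoff, i.e. Hausdorff and completely regular), is a P-space, has cardinality equal to the continuum 2^{ℵ₀}, and is not weakly Whyburn. -/
open Cardinal Set TopologicalSpace

/-- The points whose coordinates agree with the partial assignment `p`. -/
def cell {X I : Type} (e : X → I → Bool) (p : Set (I × Bool)) : Set X :=
  {x | ∀ c ∈ p, e x c.1 = c.2}

/-- A countable consistent partial assignment of Boolean values to coordinates. -/
structure IsCondition {I : Type} (p : Set (I × Bool)) : Prop where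
  countable : p.Countable
  consistent : ∀ i a b, (i, a) ∈ p → (i, b) ∈ p → a = b

/-- `S` meets the cell of every condition extending `p`. -/
def FatAlong {X I : Type} (e : X → I → Bool) (S : Set X) (p : Set (I × Bool)) : Prop :=
  ∀ q, IsCondition q → p ⊆ q → (cell e q ∩ S).Nonempty

/-- `S` is nowhere dense: every condition extends to one whose cell misses `S`. -/
def IsThin {X I : Type} (e : X → I → Bool) (S : Set X) : Prop :=
  ∀ p, IsCondition p → ∃ q, IsCondition q ∧ p ⊆ q ∧ cell e q ∩ S = ∅

section Conditions

variable {X I : Type} {e : X → I → Bool}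

lemma cell_anti {p q : Set (I × Bool)} (h : p ⊆ q) : cell e q ⊆ cell e p :=
  fun _ hx c hc => hx c (h hc)

lemma isCondition_empty : IsCondition (∅ : Set (I × Bool)) :=
  ⟨countable_empty, fun _ _ _ h => h.elim⟩

lemma isCondition_iUnion {q : ℕ → Set (I × Bool)} (hm : Monotone q)
    (hq : ∀ n, IsCondition (q n)) : IsCondition (⋃ n, q n) := by
  refine ⟨countable_iUnion fun n => (hq n).countable, fun i a b ha hb => ?_⟩
  obtain ⟨m, hm'⟩ := mem_iUnion.1 ha
  obtain ⟨n, hn⟩ := mem_iUnion.1 hb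
  exact (hq (max m n)).consistent i a b (hm (le_max_left m n) hm') (hm (le_max_right m n) hn)

/-- The graph of the coordinates of a point over a countable set of indices is a condition. -/
lemma isCondition_image (x : X) {D : Set I} (hD : D.Countable) :
    IsCondition ((fun i => (i, e x i)) '' D) := by
  refine ⟨hD.image _, ?_⟩
  rintro i a b ⟨j, _, hj⟩ ⟨k, _, hk⟩
  simp only [Prod.mk.injEq] at hj hk
  rw [← hj.2, ← hk.2, hj.1, hk.1]

lemma isCondition_union {p q : Set (I × Bool)} (hp : IsCondition p) (hq : IsCondition q)
    {x : X} (hxp : x ∈ cell e p) (hxq : x ∈ cell e q) : IsCondition (p ∪ q) := by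
  refine ⟨hp.countable.union hq.countable, fun i a b ha hb => ?_⟩
  have key : ∀ c ∈ p ∪ q, e x c.1 = c.2 := fun c hc => hc.elim (hxp c) (hxq c)
  exact (key _ ha).symm.trans (key _ hb)

lemma FatAlong.mono {S : Set X} {p q : Set (I × Bool)} (h : FatAlong e S p) (hpq : p ⊆ q) :
    FatAlong e S q :=
  fun r hr hqr => h r hr (hpq.trans hqr)

lemma exists_fatAlong_of_not_isThin {S : Set X} (h : ¬ IsThin e S) :
    ∃ p, IsCondition p ∧ FatAlong e S p := by
  unfold IsThin at h
  push Not at h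
  obtain ⟨p, hp, h⟩ := h
  exact ⟨p, hp, fun q hq hpq => h q hq hpq⟩

lemma IsThin.mono {S T : Set X} (h : IsThin e T) (hST : S ⊆ T) : IsThin e S := by
  intro p hp
  obtain ⟨q, hq, hpq, hT⟩ := h p hp
  exact ⟨q, hq, hpq, subset_eq_empty (inter_subset_inter_right _ hST) hT⟩

lemma isThin_empty : IsThin e (∅ : Set X) :=
  fun p hp => ⟨p, hp, Set.Subset.rfl, inter_empty _⟩

lemma isThin_iUnion {N : ℕ → Set X} (h : ∀ n, IsThin e (N n)) : IsThin e (⋃ n, N n) := by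
  intro p hp
  choose g hg hsub hdisj using h
  let s : ℕ → {q : Set (I × Bool) // IsCondition q} := fun n =>
    Nat.rec ⟨p, hp⟩ (fun n q => ⟨g n q.1 q.2, hg n q.1 q.2⟩) n
  have hmono : Monotone fun n => (s n).1 := monotone_nat_of_le_succ fun n => hsub n _ (s n).2
  refine ⟨⋃ n, (s n).1, isCondition_iUnion hmono fun n => (s n).2,
    subset_iUnion (fun n => (s n).1) 0, ?_⟩
  rw [eq_empty_iff_forall_notMem]
  rintro x ⟨hx, hxN⟩
  obtain ⟨n, hn⟩ := mem_iUnion.1 hxN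
  have hmem : x ∈ cell e (s (n + 1)).1 ∩ N n :=
    ⟨cell_anti (subset_iUnion (fun n => (s n).1) (n + 1)) hx, hn⟩
  rw [hdisj n _ (s n).2] at hmem
  exact hmem

lemma isThin_biUnion {J : Type} {D : Set J} (hD : D.Countable) {N : J → Set X}
    (h : ∀ j, IsThin e (N j)) : IsThin e (⋃ j ∈ D, N j) := by
  rcases D.eq_empty_or_nonempty with rfl | hne
  · simpa using isThin_empty
  · obtain ⟨f, rfl⟩ := hD.exists_eq_range hne
    rw [biUnion_range]
    exact isThin_iUnion fun n => h _

lemma IsThin.union {S T : Set X} (hS : IsThin e S) (hT : IsThin e T) : IsThin e (S ∪ T) := by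
  have := isThin_biUnion (e := e) (to_countable (univ : Set Bool))
    (N := fun b => cond b S T) (by rintro (_ | _) <;> assumption)
  refine this.mono ?_
  rintro x (hx | hx)
  · exact mem_biUnion (mem_univ true) hx
  · exact mem_biUnion (mem_univ false) hx

lemma isThin_singleton [Uncountable I] (x : X) : IsThin e {x} := by
  intro p hp
  obtain ⟨i, hi⟩ : ∃ i, i ∉ Prod.fst '' p := by
    by_contra! h
    exact not_countable_univ ((hp.countable.image Prod.fst).mono fun i _ => h i)
  have hi' : ∀ b, (i, b) ∉ p := fun b hb => hi ⟨_, hb, rfl⟩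
  refine ⟨insert (i, !e x i) p, ⟨hp.countable.insert _, ?_⟩, subset_insert _ _, ?_⟩
  · rintro j a b (ha | ha) (hb | hb)
    · simp_all
    · simp only [Prod.mk.injEq] at ha
      exact (hi' b (ha.1 ▸ hb)).elim
    · simp only [Prod.mk.injEq] at hb
      exact (hi' a (hb.1 ▸ ha)).elim
    · exact hp.consistent j a b ha hb
  · rw [eq_empty_iff_forall_notMem]
    rintro y ⟨hy, rfl⟩
    simpa using hy _ (mem_insert _ _)

lemma FatAlong.diff {S N : Set X} {p : Set (I × Bool)} (hS : FatAlong e S p)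
    (hN : IsThin e N) : FatAlong e (S \ N) p := by
  intro q hq hpq
  obtain ⟨r, hr, hqr, hrN⟩ := hN q hq
  obtain ⟨x, hxr, hxS⟩ := hS r hr (hpq.trans hqr)
  exact ⟨x, cell_anti hqr hxr, hxS, fun hxN => (hrN.subset ⟨hxr, hxN⟩).elim⟩

/-- Changing each coordinate on a thin set does not affect fatness. -/
lemma FatAlong.of_modification {e' : X → I → Bool} {M : I → Set X}
    (hM : ∀ i, IsThin e (M i)) (he : ∀ i, ∀ x ∉ M i, e' x i = e x i)
    {S : Set X} {p : Set (I × Bool)} (hS : FatAlong e S p) : FatAlong e' S p := by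
  intro q hq hpq
  obtain ⟨x, hx, hxS, hxM⟩ := hS.diff (isThin_biUnion hq.countable fun c => hM c.1) q hq hpq
  refine ⟨x, fun c hc => ?_, hxS⟩
  rw [he c.1 x fun h => hxM (mem_biUnion hc h), hx c hc]

end Conditions

open Topology

section Topology

variable {X I : Type}

/-- The topology whose basic neighbourhoods of `x` are the sets of points agreeing with `x` on
countably many coordinates. -/
@[reducible] def countableAgreementTopology (e : X → I → Bool) : TopologicalSpace X where
  IsOpen U := ∀ x ∈ U, ∃ D : Set I, D.Countable ∧ ∀ y, (∀ i ∈ D, e y i = e x i) → y ∈ U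
  isOpen_univ _ _ := ⟨∅, countable_empty, fun _ _ => mem_univ _⟩
  isOpen_inter U V hU hV x hx := by
    obtain ⟨D, hD, hDU⟩ := hU x hx.1
    obtain ⟨E, hE, hEV⟩ := hV x hx.2
    exact ⟨D ∪ E, hD.union hE, fun y hy =>
      ⟨hDU y fun i hi => hy i (Or.inl hi), hEV y fun i hi => hy i (Or.inr hi)⟩⟩
  isOpen_sUnion S hS x hx := by
    obtain ⟨U, hU, hxU⟩ := hx
    obtain ⟨D, hD, hDU⟩ := hS U hU x hxU
    exact ⟨D, hD, fun y hy => ⟨U, hU, hDU y hy⟩⟩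

variable (e : X → I → Bool)

lemma isOpen_cell {p : Set (I × Bool)} (hp : p.Countable) :
    IsOpen[countableAgreementTopology e] (cell e p) :=
  fun _ hx => ⟨Prod.fst '' p, hp.image _, fun _ hy c hc =>
    (hy c.1 (mem_image_of_mem _ hc)).trans (hx c hc)⟩

lemma isClosed_cell (p : Set (I × Bool)) :
    IsClosed[countableAgreementTopology e] (cell e p) := by
  rw [← @isOpen_compl_iff]
  intro x hx
  have : ∃ c ∈ p, e x c.1 ≠ c.2 := by
    by_contra! h
    exact hx h
  obtain ⟨c, hc, hne⟩ := this
  exact ⟨{c.1}, countable_singleton _, fun y hy hyp =>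
    hne ((hy c.1 rfl).symm.trans (hyp c hc))⟩

lemma isPSpace_countableAgreementTopology :
    @IsPSpace X (countableAgreementTopology e) := by
  intro S hS hopen x hx
  have : ∀ s : S, ∃ D : Set I, D.Countable ∧ ∀ y, (∀ i ∈ D, e y i = e x i) → y ∈ s.1 :=
    fun s => hopen s.1 s.2 x (hx s.1 s.2)
  choose D hD hDs using this
  have := hS.to_subtype
  exact ⟨⋃ s, D s, countable_iUnion hD, fun y hy s hs =>
    hDs ⟨s, hs⟩ y fun i hi => hy i (mem_iUnion.2 ⟨⟨s, hs⟩, hi⟩)⟩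

lemma isTopologicalBasis_clopens_countableAgreementTopology :
    @IsTopologicalBasis X (countableAgreementTopology e)
      {s | @IsClopen X (countableAgreementTopology e) s} := by
  let _ := countableAgreementTopology e
  refine isTopologicalBasis_of_isOpen_of_nhds (fun s hs => hs.isOpen) fun x U hx hU => ?_
  obtain ⟨D, hD, hDU⟩ := hU x hx
  refine ⟨cell e ((fun i => (i, e x i)) '' D),
    ⟨isClosed_cell e _, isOpen_cell e (hD.image _)⟩, ?_, fun y hy => hDU y fun i hi => ?_⟩
  · rintro _ ⟨i, _, rfl⟩
    rfl
  · exact hy _ (mem_image_of_mem _ hi)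

lemma t2Space_countableAgreementTopology (h : ∀ x y, x ≠ y → ∃ i, e x i ≠ e y i) :
    @T2Space X (countableAgreementTopology e) := by
  let _ := countableAgreementTopology e
  refine ⟨fun x y hxy => ?_⟩
  obtain ⟨i, hi⟩ := h x y hxy
  refine ⟨cell e {(i, e x i)}, cell e {(i, e y i)}, isOpen_cell e (countable_singleton _),
    isOpen_cell e (countable_singleton _), by simp [cell], by simp [cell], ?_⟩
  rw [Set.disjoint_left]
  intro z hz hz'
  simp only [cell, mem_singleton_iff, forall_eq, mem_ofPred_eq] at hz hz'
  exact hi (hz.symm.trans hz')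

/-- If `S` is fat along `p`, then `S` is dense in the cell of `p`. -/
lemma FatAlong.cell_subset_closure {e : X → I → Bool} {S : Set X} {p : Set (I × Bool)}
    (hp : IsCondition p) (h : FatAlong e S p) :
    cell e p ⊆ @closure X (countableAgreementTopology e) S := by
  let _ := countableAgreementTopology e
  intro x hx
  rw [mem_closure_iff]
  intro U hU hxU
  obtain ⟨D, hD, hDU⟩ := hU x hxU
  have hxD : x ∈ cell e ((fun i => (i, e x i)) '' D) := by
    rintro _ ⟨i, _, rfl⟩
    rfl
  obtain ⟨y, hy, hyS⟩ := h _ (isCondition_union hp (isCondition_image x hD) hx hxD)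
    subset_union_left
  exact ⟨y, hDU y fun i hi => hy _ (Or.inr (mem_image_of_mem _ hi)), hyS⟩

end Topology

section Modification

variable {X : Type}

open Classical in
/-- The coordinates indexed by `(N, y)` with `N` thin, changed so as to be true on `N \ {y}`
and false at `y`. -/
noncomputable def separatingCoordinates (e : X → Set X × X → Bool) (x : X) (i : Set X × X) :
    Bool :=
  if IsThin e i.1 then if x = i.2 then false else if x ∈ i.1 then true else e x i else e x i

variable {e : X → Set X × X → Bool}

lemma separatingCoordinates_apply_self {N : Set X} (hN : IsThin e N) (y : X) :
    separatingCoordinates e y (N, y) = false := by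
  simp [separatingCoordinates, hN]

lemma separatingCoordinates_apply_of_mem {N : Set X} (hN : IsThin e N) {x y : X}
    (hx : x ∈ N) (hy : y ∉ N) : separatingCoordinates e x (N, y) = true := by
  have : x ≠ y := fun h => hy (h ▸ hx)
  simp [separatingCoordinates, hN, hx, this]

lemma FatAlong.separatingCoordinates [Uncountable (Set X × X)] {S : Set X}
    {p : Set ((Set X × X) × Bool)} (h : FatAlong e S p) :
    FatAlong (separatingCoordinates e) S p := by
  refine h.of_modification (M := fun i => {x | IsThin e i.1 ∧ x ∈ i.1 ∪ {i.2}})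
    (fun i => ?_) fun i x hx => ?_
  · by_cases hi : IsThin e i.1
    · exact (hi.union (isThin_singleton i.2)).mono fun x hx => hx.2
    · exact isThin_empty.mono fun x hx => hi hx.1
  · by_cases hi : IsThin e i.1
    · have hx' : x ∉ i.1 ∪ {i.2} := fun h => hx ⟨hi, h⟩
      simp only [mem_union, mem_singleton_iff, not_or] at hx'
      simp [_root_.separatingCoordinates, hi, hx'.1, hx'.2]
    · simp [_root_.separatingCoordinates, hi]

lemma IsThin.isClosed_separatingCoordinates {N : Set X} (hN : IsThin e N) :
    IsClosed[countableAgreementTopology (separatingCoordinates e)] N := by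
  rw [← @isOpen_compl_iff]
  intro y hy
  refine ⟨{(N, y)}, countable_singleton _, fun x hx hxN => ?_⟩
  have := hx _ rfl
  rw [separatingCoordinates_apply_self hN,
    separatingCoordinates_apply_of_mem hN hxN hy] at this
  cases this

lemma exists_separatingCoordinates_ne [Uncountable (Set X × X)] {x y : X} (h : x ≠ y) :
    ∃ i, separatingCoordinates e x i ≠ separatingCoordinates e y i := by
  refine ⟨({x}, y), ?_⟩
  rw [separatingCoordinates_apply_self (isThin_singleton x),
    separatingCoordinates_apply_of_mem (isThin_singleton x) rfl fun h' => h h'.symm]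
  decide

/-- A set which is dense and codense witnesses the failure of the weak Whyburn property. -/
lemma not_isWeaklyWhyburn_separatingCoordinates [Uncountable (Set X × X)] {A : Set X}
    (hA : FatAlong e A ∅) (hA' : FatAlong e Aᶜ ∅) :
    ¬ @IsWeaklyWhyburn X (countableAgreementTopology (separatingCoordinates e)) := by
  let _ := countableAgreementTopology (separatingCoordinates e)
  intro hW
  have hnot : ¬ IsClosed A := by
    intro hc
    obtain ⟨x, -, hx⟩ := hA' ∅ isCondition_empty Set.Subset.rfl
    exact hx (hc.closure_subset (hA.separatingCoordinates.cell_subset_closure isCondition_empty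
      fun c hc => hc.elim))
  obtain ⟨x, -, F, hFA, hF⟩ := hW A hnot
  by_cases hthin : IsThin e F
  · rw [hthin.isClosed_separatingCoordinates.closure_eq, sdiff_self] at hF
    exact (singleton_ne_empty x) hF.symm
  · obtain ⟨p, hp, hfat⟩ := exists_fatAlong_of_not_isThin hthin
    obtain ⟨y, hyp, hyA, hyx⟩ := ((hA'.mono (empty_subset p)).diff
      (isThin_singleton x)).separatingCoordinates p hp Set.Subset.rfl
    have : y ∈ closure F \ F :=
      ⟨hfat.separatingCoordinates.cell_subset_closure hp hyp, fun h => hyA (hFA h)⟩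
    rw [hF] at this
    exact hyx this

end Modification

section Independent

open Classical in
/-- The Hausdorff-type independent family of subsets of a set of size continuum, indexed by sets
of reals. -/
noncomputable def hausdorffCoordinate (x : (ℕ → ℝ) × (ℕ → Option (Set ℕ))) (Z : Set ℝ) : Bool :=
  decide (∃ n, x.2 n = some (x.1 ⁻¹' Z))

lemma exists_hausdorffCoordinate_eq {I : Type} {ι : I → Set ℝ} (hι : Function.Injective ι)
    {p : Set (I × Bool)} (hp : IsCondition p) :
    ∃ x, ∀ c ∈ p, hausdorffCoordinate x (ι c.1) = c.2 := by
  have hsep : ∀ c : (I × Bool) × (I × Bool), ∃ r : ℝ,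
      ι c.1.1 ≠ ι c.2.1 → ¬ (r ∈ ι c.1.1 ↔ r ∈ ι c.2.1) := by
    intro c
    by_contra! h
    exact (h 0).1 (Set.ext fun r => (h r).2)
  choose r hr using hsep
  obtain ⟨d, hd⟩ := (((hp.countable.prod hp.countable).image r).insert 0).exists_eq_range
    (insert_nonempty _ _)
  obtain ⟨s, hs⟩ := ((hp.countable.image fun c =>
    if c.2 then some (d ⁻¹' ι c.1) else none).insert none).exists_eq_range (insert_nonempty _ _)
  refine ⟨(d, s), fun c hc => ?_⟩
  have hiff : (∃ n, s n = some (d ⁻¹' ι c.1)) ↔ c.2 = true := by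
    rw [← mem_range, ← hs]
    constructor
    · rintro (h | ⟨b, hb, hbc⟩)
      · cases h
      · dsimp only at hbc
        split_ifs at hbc with hb2
        have hpre : d ⁻¹' ι b.1 = d ⁻¹' ι c.1 := Option.some_injective _ hbc
        have heq : b.1 = c.1 := by
          by_contra hne
          have hrange : r (b, c) ∈ range d := by
            rw [← hd]
            exact Or.inr ⟨(b, c), ⟨hb, hc⟩, rfl⟩
          obtain ⟨n, hn⟩ := hrange
          refine hr (b, c) (fun h => hne (hι h)) ?_
          rw [← hn]
          exact Set.ext_iff.1 hpre n
        exact hp.consistent c.1 c.2 true hc (heq ▸ hb2 ▸ hb)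
    · intro h
      exact Or.inr ⟨c, hc, by simp [h]⟩
  rw [Bool.eq_iff_iff, ← hiff]
  simp [hausdorffCoordinate]

end Independent

/-- There exists a completely regular (Tychonoff) P-space of cardinality continuum
which is not weakly Whyburn. -/
theorem statement1 :
    ∃ (X : Type) (_ : TopologicalSpace X),
      T2Space X ∧ CompletelyRegularSpace X ∧
      IsPSpace X ∧ Cardinal.mk X = 2 ^ Cardinal.aleph0 ∧ ¬ IsWeaklyWhyburn X := by
  let X : Type := ((ℕ → ℝ) × (ℕ → Option (Set ℕ))) × Bool
  have hcard : #X = 𝔠 := by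
    have h1 : #(ℕ → ℝ) = 𝔠 := by simp [Cardinal.mk_real]
    have h2 : #(ℕ → Option (Set ℕ)) = 𝔠 := by
      simp [Cardinal.mk_option, Cardinal.add_one_eq Cardinal.aleph0_le_continuum]
    simp only [X, mk_prod, lift_id, h1, h2]
    simp
  obtain ⟨φ⟩ : Nonempty (X ⊕ X ↪ ℝ) := by
    rw [← Cardinal.le_def]
    simp [hcard, Cardinal.mk_real]
  let ι : Set X × X → Set ℝ := fun i => φ '' (Sum.inl '' i.1 ∪ Sum.inr '' {i.2})
  have hι : Function.Injective ι := by
    rintro ⟨N, y⟩ ⟨M, z⟩ h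
    have h' := φ.injective.image_injective h
    have hN : N = M := Set.ext fun x => by simpa using Set.ext_iff.1 h' (Sum.inl x)
    have hy : y = z := by simpa using Set.ext_iff.1 h' (Sum.inr y)
    rw [hN, hy]
  have hunc : Uncountable X := by
    rw [← Cardinal.aleph0_lt_mk_iff, hcard]
    exact Cardinal.aleph0_lt_continuum
  have : Uncountable (Set X × X) :=
    (show Function.Injective fun x : X => ((∅ : Set X), x) from
      fun x y h => (Prod.mk.inj h).2).uncountable
  let e : X → Set X × X → Bool := fun x i => hausdorffCoordinate x.1 (ι i)
  have hfat : ∀ b : Bool, FatAlong e {x | x.2 = b} ∅ := by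
    intro b q hq _
    obtain ⟨x, hx⟩ := exists_hausdorffCoordinate_eq hι hq
    exact ⟨(x, b), hx, rfl⟩
  refine ⟨X, countableAgreementTopology (separatingCoordinates e),
    t2Space_countableAgreementTopology _ fun x y => exists_separatingCoordinates_ne,
    @CompletelyRegularSpace.of_isTopologicalBasis_clopens _ (_)
      (isTopologicalBasis_clopens_countableAgreementTopology _),
    isPSpace_countableAgreementTopology _, by rw [hcard, two_power_aleph0],
    not_isWeaklyWhyburn_separatingCoordinates (hfat true) ?_⟩
  convert hfat false using 1
  ext x
  simp
end

section
/- There exists a topological space X which is T1, regular, dense-in-itself (has no isolated points), is a P-space, has cardinality equal to the continuum 2^{ℵ₀}, and in which every meager set (countable union of nowhere dense sets) is nowhere dense. -/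
open Cardinal Set TopologicalSpace

/-- The countable sets of real numbers. -/
def CountableSets : Type := {A : Set ℝ // A.Countable}

namespace CountableSets

/-- The countable sets that have the same trace on `C` as `A`. -/
def cylinder (A : CountableSets) (C : Set ℝ) : Set CountableSets :=
  {B | ∀ x ∈ C, x ∈ B.1 ↔ x ∈ A.1}

theorem mem_cylinder_self (A : CountableSets) (C : Set ℝ) : A ∈ A.cylinder C :=
  fun _ _ => Iff.rfl

theorem cylinder_anti (A : CountableSets) {C D : Set ℝ} (h : C ⊆ D) :
    A.cylinder D ⊆ A.cylinder C :=
  fun _ hB x hx => hB x (h hx)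

theorem cylinder_subset_of_mem {A B : CountableSets} {C : Set ℝ} (h : B ∈ A.cylinder C) :
    B.cylinder C ⊆ A.cylinder C :=
  fun _ hE x hx => (hE x hx).trans (h x hx)

/-- The topology generated by the cylinders over countable sets. -/
instance : TopologicalSpace CountableSets where
  IsOpen U := ∀ A ∈ U, ∃ C : Set ℝ, C.Countable ∧ A.cylinder C ⊆ U
  isOpen_univ _ _ := ⟨∅, countable_empty, subset_univ _⟩
  isOpen_inter U V hU hV A hA := by
    obtain ⟨C, hC, hCU⟩ := hU A hA.1
    obtain ⟨D, hD, hDV⟩ := hV A hA.2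
    exact ⟨C ∪ D, hC.union hD, subset_inter
      ((A.cylinder_anti subset_union_left).trans hCU)
      ((A.cylinder_anti subset_union_right).trans hDV)⟩
  isOpen_sUnion S hS A := by
    rintro ⟨U, hU, hA⟩
    obtain ⟨C, hC, hCU⟩ := hS U hU A hA
    exact ⟨C, hC, hCU.trans (subset_sUnion_of_mem hU)⟩

theorem isOpen_iff {U : Set CountableSets} :
    IsOpen U ↔ ∀ A ∈ U, ∃ C : Set ℝ, C.Countable ∧ A.cylinder C ⊆ U :=
  Iff.rfl

theorem isOpen_cylinder (A : CountableSets) {C : Set ℝ} (hC : C.Countable) :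
    IsOpen (A.cylinder C) :=
  isOpen_iff.2 fun _ hB => ⟨C, hC, cylinder_subset_of_mem hB⟩

theorem isClosed_cylinder (A : CountableSets) {C : Set ℝ} (hC : C.Countable) :
    IsClosed (A.cylinder C) := by
  refine ⟨isOpen_iff.2 fun B hB => ⟨C, hC, fun E hE hEA => hB fun x hx => ?_⟩⟩
  exact (hE x hx).symm.trans (hEA x hx)

instance : T1Space CountableSets := by
  refine ⟨fun A => ⟨isOpen_iff.2 fun B hB => ⟨A.1 ∪ B.1, A.2.union B.2, ?_⟩⟩⟩
  rintro E hE rfl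
  refine hB (Subtype.ext (Set.ext fun x => ⟨fun hx => ?_, fun hx => ?_⟩))
  · exact (hE x (Or.inr hx)).2 hx
  · exact (hE x (Or.inl hx)).1 hx

instance : RegularSpace CountableSets := by
  refine RegularSpace.of_exists_mem_nhds_isClosed_subset fun A s hs => ?_
  obtain ⟨U, hUs, hU, hA⟩ := mem_nhds_iff.1 hs
  obtain ⟨C, hC, hCU⟩ := isOpen_iff.1 hU A hA
  exact ⟨A.cylinder C, (A.isOpen_cylinder hC).mem_nhds (A.mem_cylinder_self C),
    A.isClosed_cylinder hC, hCU.trans hUs⟩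

theorem not_isOpen_singleton (A : CountableSets) : ¬ IsOpen ({A} : Set CountableSets) := by
  intro h
  obtain ⟨C, hC, hCA⟩ := isOpen_iff.1 h A rfl
  obtain ⟨x, hx⟩ : ∃ x, x ∉ A.1 ∪ C := by
    by_contra! hall
    exact Set.not_countable_univ ((A.2.union hC).mono fun x _ => hall x)
  let B : CountableSets := ⟨insert x A.1, A.2.insert x⟩
  have hB : B ∈ A.cylinder C := fun y hy => by
    refine ⟨fun h => h.resolve_left ?_, Or.inr⟩
    rintro rfl
    exact hx (Or.inr hy)
  have hBA : B = A := hCA hB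
  have hxB : x ∈ B.1 := mem_insert x A.1
  rw [hBA] at hxB
  exact hx (Or.inl hxB)

theorem isPSpace : IsPSpace CountableSets := by
  intro S hS hopen
  refine isOpen_iff.2 fun A hA => ?_
  choose! C hC hCU using fun s hs => isOpen_iff.1 (hopen s hs) A (hA s hs)
  exact ⟨⋃ s ∈ S, C s, hS.biUnion hC, subset_sInter fun s hs =>
    (A.cylinder_anti (subset_biUnion_of_mem hs)).trans (hCU s hs)⟩

theorem mk_eq : Cardinal.mk CountableSets = 2 ^ aleph0 := by
  rw [two_power_aleph0]
  apply le_antisymm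
  · let f : (ℕ → Option ℝ) → CountableSets := fun u =>
      ⟨some ⁻¹' range u, (countable_range u).preimage (Option.some_injective ℝ)⟩
    have hf : Function.Surjective f := by
      intro A
      obtain ⟨u, hu⟩ := ((A.2.image some).insert none).exists_eq_range (insert_nonempty _ _)
      refine ⟨u, Subtype.ext (Set.ext fun x => ?_)⟩
      simp [f, ← hu]
    refine (mk_le_of_surjective hf).trans ?_
    simp [mk_real, add_one_eq aleph0_le_continuum]
  · rw [← mk_real]
    exact mk_le_of_injective (f := fun x : ℝ => (⟨{x}, countable_singleton x⟩ : CountableSets))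
      fun x y h => singleton_injective (congrArg Subtype.val h)

theorem isNowhereDense_iff {N : Set CountableSets} :
    IsNowhereDense N ↔ ∀ (A : CountableSets) (C : Set ℝ), C.Countable →
      ∃ B ∈ A.cylinder C, ∃ D : Set ℝ, D.Countable ∧ C ⊆ D ∧ Disjoint (B.cylinder D) N := by
  constructor
  · intro hN A C hC
    have hsub : ¬ A.cylinder C ⊆ closure N := fun h => by
      have hA := interior_maximal h (A.isOpen_cylinder hC) (A.mem_cylinder_self C)
      rw [hN] at hA
      exact hA
    obtain ⟨B, hB, hBN⟩ := not_subset.1 hsub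
    obtain ⟨D, hD, hDN⟩ := isOpen_iff.1 isClosed_closure.isOpen_compl B hBN
    refine ⟨B, hB, C ∪ D, hC.union hD, subset_union_left, disjoint_left.2 fun E hE hEN => ?_⟩
    exact hDN (B.cylinder_anti subset_union_right hE) (subset_closure hEN)
  · intro h
    refine eq_empty_of_forall_notMem fun A hA => ?_
    obtain ⟨C, hC, hCN⟩ := isOpen_iff.1 isOpen_interior A hA
    obtain ⟨B, hB, D, hD, -, hdisj⟩ := h A C hC
    obtain ⟨E, hE, hEN⟩ := mem_closure_iff.1 (interior_subset (hCN hB)) _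
      (B.isOpen_cylinder hD) (B.mem_cylinder_self D)
    exact disjoint_left.1 hdisj hE hEN

/-- Countable decreasing sequences of cylinders have a cylinder as a lower bound. -/
theorem exists_cylinder_subset {A : ℕ → CountableSets} {C : ℕ → Set ℝ}
    (hC : ∀ n, (C n).Countable) (hmono : Monotone C)
    (hA : ∀ n, A (n + 1) ∈ (A n).cylinder (C n)) :
    ∃ B : CountableSets, ∀ n, B.cylinder (⋃ n, C n) ⊆ (A n).cylinder (C n) := by
  have hanti : Antitone fun n => (A n).cylinder (C n) := antitone_nat_of_succ_le fun n =>
    ((A (n + 1)).cylinder_anti (hmono n.le_succ)).trans (cylinder_subset_of_mem (hA n))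
  let B : CountableSets := ⟨⋃ n, (A n).1 ∩ C n,
    countable_iUnion fun n => (hC n).mono inter_subset_right⟩
  have hB : ∀ n, B ∈ (A n).cylinder (C n) := fun n x hx => by
    constructor
    · intro hxB
      obtain ⟨m, hxA, hxC⟩ := mem_iUnion.1 hxB
      rcases le_total m n with hmn | hnm
      · exact (hanti hmn ((A n).mem_cylinder_self _) x hxC).2 hxA
      · exact (hanti hnm ((A m).mem_cylinder_self _) x hx).1 hxA
    · exact fun hxA => mem_iUnion.2 ⟨n, hxA, hx⟩
  exact ⟨B, fun n =>
    (B.cylinder_anti (subset_iUnion C n)).trans (cylinder_subset_of_mem (hB n))⟩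

theorem isNowhereDense_iUnion {N : ℕ → Set CountableSets} (hN : ∀ n, IsNowhereDense (N n)) :
    IsNowhereDense (⋃ n, N n) := by
  refine isNowhereDense_iff.2 fun A C hC => ?_
  choose next hnext D hD hCD hdisj using fun n => isNowhereDense_iff.1 (hN n)
  let p : ℕ → CountableSets × {C : Set ℝ // C.Countable} := fun n =>
    Nat.rec (A, ⟨C, hC⟩)
      (fun k q => (next k q.1 q.2.1 q.2.2, ⟨D k q.1 q.2.1 q.2.2, hD k q.1 q.2.1 q.2.2⟩)) n
  obtain ⟨B, hB⟩ := exists_cylinder_subset (A := fun n => (p n).1) (C := fun n => (p n).2.1)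
    (fun n => (p n).2.2) (monotone_nat_of_le_succ fun n => hCD n _ _ _)
    (fun n => hnext n _ _ _)
  refine ⟨B, hB 0 (B.mem_cylinder_self _), ⋃ n, (p n).2.1,
    countable_iUnion fun n => (p n).2.2, subset_iUnion (fun n => (p n).2.1) 0, ?_⟩
  exact disjoint_iUnion_right.2 fun n => (hdisj n _ _ _).mono_left (hB (n + 1))

theorem isNowhereDense_sUnion {S : Set (Set CountableSets)} (hS : S.Countable)
    (h : ∀ s ∈ S, IsNowhereDense s) : IsNowhereDense (⋃₀ S) := by
  rcases S.eq_empty_or_nonempty with rfl | hne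
  · simp [IsNowhereDense]
  · obtain ⟨N, rfl⟩ := hS.exists_eq_range hne
    rw [sUnion_range]
    exact isNowhereDense_iUnion fun n => h _ (mem_range_self n)

end CountableSets

/-- There exists a T1 regular dense-in-itself P-space of cardinality continuum in
which every countable union of nowhere dense sets is nowhere dense. -/
theorem statement2 :
    ∃ (X : Type) (_ : TopologicalSpace X),
      T1Space X ∧ RegularSpace X ∧
      (∀ x : X, ¬ IsOpen ({x} : Set X)) ∧
      IsPSpace X ∧ Cardinal.mk X = 2 ^ Cardinal.aleph0 ∧
      (∀ S : Set (Set X), S.Countable → (∀ s ∈ S, IsNowhereDense s) →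
        IsNowhereDense (⋃₀ S)) :=
  ⟨CountableSets, inferInstance, inferInstance, inferInstance,
    CountableSets.not_isOpen_singleton, CountableSets.isPSpace, CountableSets.mk_eq,
    fun _ => CountableSets.isNowhereDense_sUnion⟩
end

section
/- There exists a topological space W which is Hausdorff, a weak P-space (every countable subset of W is closed), has cardinality ℵ₁, and is not weakly Whyburn. -/
open Cardinal Set TopologicalSpace

open Topology

/-- The disjoint union of a discrete space `A` and a set `B`, where the trace on `A` of the
neighbourhoods of `b : B` is the filter `𝓕 b` and `B` is discrete. -/
def FilterSum {A B : Type*} (_ : B → Filter A) := A ⊕ B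

namespace FilterSum

variable {A B : Type*} {𝓕 : B → Filter A}

/-- The points of the discrete part of `FilterSum 𝓕`. -/
def pt (𝓕 : B → Filter A) (a : A) : FilterSum 𝓕 := Sum.inl a

/-- The limit points added in `FilterSum 𝓕`. -/
def lim (𝓕 : B → Filter A) (b : B) : FilterSum 𝓕 := Sum.inr b

theorem pt_injective : Function.Injective (pt 𝓕) := Sum.inl_injective

theorem lim_injective : Function.Injective (lim 𝓕) := Sum.inr_injective

theorem pt_ne_lim (a : A) (b : B) : pt 𝓕 a ≠ lim 𝓕 b := Sum.inl_ne_inr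

theorem eq_pt_or_eq_lim (x : FilterSum 𝓕) : (∃ a, x = pt 𝓕 a) ∨ ∃ b, x = lim 𝓕 b := by
  rcases x with a | b
  exacts [Or.inl ⟨a, rfl⟩, Or.inr ⟨b, rfl⟩]

instance : TopologicalSpace (FilterSum 𝓕) where
  IsOpen s := ∀ b, lim 𝓕 b ∈ s → pt 𝓕 ⁻¹' s ∈ 𝓕 b
  isOpen_univ _ _ := Filter.univ_mem
  isOpen_inter _ _ hs ht b hb := Filter.inter_mem (hs b hb.1) (ht b hb.2)
  isOpen_sUnion S hS b := by
    rintro ⟨s, hs, hb⟩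
    exact Filter.mem_of_superset (hS s hs b hb) (preimage_mono (subset_sUnion_of_mem hs))

theorem isOpen_iff {s : Set (FilterSum 𝓕)} :
    IsOpen s ↔ ∀ b, lim 𝓕 b ∈ s → pt 𝓕 ⁻¹' s ∈ 𝓕 b := Iff.rfl

theorem isOpen_image_pt (s : Set A) : IsOpen (pt 𝓕 '' s) := by
  rintro b ⟨a, -, h⟩
  exact absurd h (pt_ne_lim a b)

theorem isOpen_insert_lim {b : B} {s : Set A} (hs : s ∈ 𝓕 b) :
    IsOpen (insert (lim 𝓕 b) (pt 𝓕 '' s)) := by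
  rintro c (h | ⟨a, -, h⟩)
  · rw [lim_injective h]
    filter_upwards [hs] with a ha using Or.inr ⟨a, ha, rfl⟩
  · exact absurd h (pt_ne_lim a c)

theorem lim_mem_closure {b : B} {F : Set (FilterSum 𝓕)} :
    lim 𝓕 b ∈ closure F ↔ lim 𝓕 b ∈ F ∨ ∃ᶠ a in 𝓕 b, pt 𝓕 a ∈ F := by
  rw [mem_closure_iff]
  constructor
  · intro h
    by_contra! hF
    obtain ⟨hb, hF⟩ := hF
    obtain ⟨x, (rfl | ⟨a, ha, rfl⟩), hxF⟩ :=
      h _ (isOpen_insert_lim hF) (mem_insert _ _)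
    exacts [hb hxF, ha hxF]
  · rintro (h | h) o ho hb
    · exact ⟨_, hb, h⟩
    · obtain ⟨a, haF, hao⟩ := (h.and_eventually (ho b hb)).exists
      exact ⟨_, hao, haF⟩

theorem t2Space (hcof : ∀ b a, {a}ᶜ ∈ 𝓕 b) (hdisj : Pairwise (Function.onFun Disjoint 𝓕)) :
    T2Space (FilterSum 𝓕) := by
  have key (a : A) (b : B) : ∃ u v : Set (FilterSum 𝓕), IsOpen u ∧ IsOpen v ∧ pt 𝓕 a ∈ u ∧
      lim 𝓕 b ∈ v ∧ Disjoint u v := by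
    refine ⟨_, _, isOpen_image_pt {a}, isOpen_insert_lim (hcof b a), ⟨a, rfl, rfl⟩,
      mem_insert _ _, ?_⟩
    rw [disjoint_left]
    rintro _ ⟨a, rfl, rfl⟩ (h | ⟨a', h', h⟩)
    exacts [pt_ne_lim _ _ h, h' (pt_injective h)]
  refine ⟨fun x y hxy ↦ ?_⟩
  obtain ⟨a, rfl⟩ | ⟨b, rfl⟩ := eq_pt_or_eq_lim x <;>
    obtain ⟨a', rfl⟩ | ⟨b', rfl⟩ := eq_pt_or_eq_lim y
  · refine ⟨_, _, isOpen_image_pt {a}, isOpen_image_pt {a'}, ⟨a, rfl, rfl⟩, ⟨a', rfl, rfl⟩, ?_⟩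
    simpa using hxy
  · exact key a b'
  · obtain ⟨u, v, hu, hv, ha, hb, h⟩ := key a' b
    exact ⟨v, u, hv, hu, hb, ha, h.symm⟩
  · have hne : b ≠ b' := fun h ↦ hxy (h ▸ rfl)
    obtain ⟨s, hs, t, ht, hst⟩ := Filter.disjoint_iff.1 (hdisj hne)
    refine ⟨_, _, isOpen_insert_lim hs, isOpen_insert_lim ht, mem_insert _ _,
      mem_insert _ _, ?_⟩
    rw [disjoint_left]
    rintro _ (rfl | ⟨a, ha, rfl⟩) (h | ⟨a', ha', h⟩)
    · exact hxy h
    · exact pt_ne_lim _ _ h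
    · exact pt_ne_lim _ _ h
    · exact disjoint_left.1 hst ha (pt_injective h ▸ ha')

theorem isClosed_of_countable (hcoc : ∀ b, ∀ s : Set A, s.Countable → sᶜ ∈ 𝓕 b)
    {C : Set (FilterSum 𝓕)} (hC : C.Countable) : IsClosed C :=
  ⟨fun b _ ↦ hcoc b _ (hC.preimage pt_injective)⟩

theorem not_isWeaklyWhyburn [Nonempty B] [∀ b, (𝓕 b).NeBot]
    (h : ∀ b, ∀ s : Set A, (∃ᶠ a in 𝓕 b, a ∈ s) → ∃ c ≠ b, ∃ᶠ a in 𝓕 c, a ∈ s) :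
    ¬ IsWeaklyWhyburn (FilterSum 𝓕) := by
  intro hW
  have hlim (b : B) : lim 𝓕 b ∉ range (pt 𝓕) := fun ⟨a, ha⟩ ↦ pt_ne_lim a b ha
  have hA : ¬ IsClosed (range (pt 𝓕)) := by
    intro hcl
    obtain ⟨b⟩ := ‹Nonempty B›
    refine hlim b (hcl.closure_subset (lim_mem_closure.2 (Or.inr ?_)))
    exact (Filter.Eventually.of_forall fun a ↦ mem_range_self a).frequently
  obtain ⟨x, ⟨-, hx⟩, F, hFA, hF⟩ := hW _ hA
  obtain ⟨a, rfl⟩ | ⟨b, rfl⟩ := eq_pt_or_eq_lim x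
  · exact hx (mem_range_self a)
  have hb : lim 𝓕 b ∈ closure F \ F := hF ▸ mem_singleton _
  obtain ⟨c, hcb, hc⟩ := h b (pt 𝓕 ⁻¹' F) ((lim_mem_closure.1 hb.1).resolve_left hb.2)
  have hc' : lim 𝓕 c ∈ closure F \ F :=
    ⟨lim_mem_closure.2 (Or.inr hc), fun h ↦ hlim c (hFA h)⟩
  rw [hF] at hc'
  exact hcb (lim_injective hc')

end FilterSum

/-- Every filter whose members have dense image under `f` can be refined to a minimal such filter;
every set that is frequently met by it contains, modulo the filter, the preimage of a nonempty
open set. -/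
theorem Filter.exists_le_irreducible {A X : Type*} [TopologicalSpace X] (f : A → X)
    (𝓗 : Filter A) (h𝓗 : ∀ s ∈ 𝓗, Dense (f '' s)) :
    ∃ 𝓖 ≤ 𝓗, (∀ s ∈ 𝓖, Dense (f '' s)) ∧ ∀ s : Set A, (∃ᶠ a in 𝓖, a ∈ s) →
      ∃ V : Set X, IsOpen V ∧ V.Nonempty ∧ ∀ᶠ a in 𝓖, f a ∈ V → a ∈ s := by
  obtain ⟨𝓖, hle, h𝓖⟩ := zorn_le_nonempty₀ (α := (Filter A)ᵒᵈ)
    {𝓖 | ∀ s ∈ OrderDual.ofDual 𝓖, Dense (f '' s)} (by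
      intro c hc hchain 𝓖₀ h𝓖₀
      refine ⟨OrderDual.toDual (⨅ g ∈ c, OrderDual.ofDual g), ?_, fun g hg ↦ ?_⟩
      · intro s hs
        have hdir : DirectedOn (OrderDual.ofDual ⁻¹'o (· ≥ ·)) c := by
          intro g hg g' hg'
          rcases hchain.total hg hg' with h | h
          exacts [⟨g', hg', h, le_refl _⟩, ⟨g, hg, le_refl _, h⟩]
        obtain ⟨g, hg, hsg⟩ := (Filter.mem_biInf_of_directed hdir ⟨𝓖₀, h𝓖₀⟩).1 hs
        exact hc hg s hsg
      · exact iInf₂_le (f := fun (g : (Filter A)ᵒᵈ) (_ : g ∈ c) ↦ OrderDual.ofDual g) g hg)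
    (OrderDual.toDual 𝓗) h𝓗
  refine ⟨OrderDual.ofDual 𝓖, hle, h𝓖.prop, fun s hs ↦ ?_⟩
  by_contra! hV
  refine hs (?_ : sᶜ ∈ OrderDual.ofDual 𝓖)
  have hP : ∀ t ∈ OrderDual.ofDual 𝓖 ⊓ Filter.principal sᶜ, Dense (f '' t) := by
    intro t ht
    rw [Filter.mem_inf_principal] at ht
    rw [dense_iff_inter_open]
    intro V hVo hVn
    obtain ⟨a, ha, hat⟩ := ((hV V hVo hVn).and_eventually ht).exists
    exact ⟨f a, ha.1, a, hat ha.2, rfl⟩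
  have hle' : OrderDual.ofDual 𝓖 ≤ OrderDual.ofDual 𝓖 ⊓ Filter.principal sᶜ :=
    h𝓖.le_of_ge (y := OrderDual.toDual (OrderDual.ofDual 𝓖 ⊓ Filter.principal sᶜ)) hP
      (inf_le_left (a := OrderDual.ofDual 𝓖))
  exact Filter.le_principal_iff.1 (hle'.trans inf_le_right)

/-- There exists a Hausdorff weak P-space (every countable set is closed) of
cardinality ℵ₁ which is not weakly Whyburn. -/
theorem statement3 :
    ∃ (W : Type) (_ : TopologicalSpace W),
      T2Space W ∧ (∀ C : Set W, C.Countable → IsClosed C) ∧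
      Cardinal.mk W = Cardinal.aleph 1 ∧ ¬ IsWeaklyWhyburn W := by
  obtain ⟨T, hT⟩ : ∃ T : Type, #T = ℵ₁ := ⟨_, mk_out _⟩
  have : Uncountable T := by
    rw [← aleph0_lt_mk_iff, hT]; exact aleph0_lt_aleph_one
  obtain ⟨𝓖, hle, hdense, hirr⟩ := Filter.exists_le_irreducible (Prod.snd : T × ℚ → ℚ)
    Filter.cocountable (by
      intro s hs
      rw [Filter.mem_cocountable] at hs
      have hsurj : Prod.snd '' s = (univ : Set ℚ) := by
        refine eq_univ_of_forall fun q ↦ ?_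
        by_contra hq
        refine not_countable_univ (α := T)
          ((hs.preimage (Prod.mk_left_injective q)).mono fun t _ ht ↦ hq ⟨(t, q), ht, rfl⟩)
      rw [hsurj]
      exact dense_univ)
  let 𝓕 : ℚ → Filter (T × ℚ) := fun q ↦ 𝓖 ⊓ Filter.comap Prod.snd (𝓝 q)
  have hcoc (q : ℚ) (s : Set (T × ℚ)) (hs : s.Countable) : sᶜ ∈ 𝓕 q :=
    Filter.mem_inf_of_left (hle (by rwa [Filter.mem_cocountable, compl_compl]))
  have hne (q : ℚ) : (𝓕 q).NeBot := by
    rw [Filter.inf_neBot_iff]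
    rintro s hs t ⟨u, hu, hut⟩
    obtain ⟨_, hau, a, has, rfl⟩ := mem_closure_iff_nhds.1 (hdense s hs q) u hu
    exact ⟨a, has, hut hau⟩
  refine ⟨FilterSum 𝓕, inferInstance, FilterSum.t2Space
    (fun b a ↦ hcoc b _ (countable_singleton a)) (fun p q hpq ↦ ?_),
    fun C hC ↦ FilterSum.isClosed_of_countable hcoc hC, ?_,
    FilterSum.not_isWeaklyWhyburn fun q s hs ↦ ?_⟩
  · exact (Filter.disjoint_comap (disjoint_nhds_nhds.2 hpq)).mono inf_le_right inf_le_right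
  · change #((T × ℚ) ⊕ ℚ) = ℵ₁
    have h0 : ℵ₀ ≤ (ℵ₁ : Cardinal.{0}) := aleph0_le_aleph 1
    rw [mk_sum, mk_prod, lift_id, lift_id, lift_id, hT, Cardinal.mkRat,
      mul_eq_left h0 h0 aleph0_ne_zero, add_eq_left h0 h0]
  · obtain ⟨V, hVo, ⟨v, hv⟩, hVs⟩ := hirr s (hs.filter_mono inf_le_left)
    obtain ⟨c, hcq, hcV⟩ : ∃ c ≠ q, c ∈ V :=
      ((dense_compl_singleton q).inter_open_nonempty V hVo ⟨v, hv⟩).imp fun c hc ↦ ⟨hc.2, hc.1⟩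
    refine ⟨c, hcq, Filter.Eventually.frequently ?_⟩
    filter_upwards [Filter.mem_inf_of_left hVs,
      Filter.mem_inf_of_right (Filter.preimage_mem_comap (hVo.mem_nhds hcV))] with a h₁ h₂
    exact h₁ h₂
end

section
/- Assume the Continuum Hypothesis (2^{ℵ₀} = ℵ₁). Then there exists a topological space X which is regular Hausdorff, Lindelöf, a weak P-space (every countable subset is closed), has cardinality ℵ₁, has character ℵ₁ (every point has a neighbourhood base of cardinality at most ℵ₁), and is not weakly Whyburn. -/
open Cardinal Set TopologicalSpace

open MeasureTheory Filter Topology Metric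
open scoped ENNReal

section Density

/-- The point `p` is a dispersion point of `S`: the outer Lebesgue density of `S` at `p` is zero. -/
def IsDispersedAt (S : Set ℝ) (p : ℝ) : Prop :=
  Tendsto (fun r => volume (S ∩ closedBall p r) / volume (closedBall p r)) (𝓝[>] 0) (𝓝 0)

variable {S T E U : Set ℝ} {p : ℝ}

theorem IsDispersedAt.of_eventually_le (hT : IsDispersedAt T p)
    (h : ∀ r, volume (S ∩ closedBall p r) ≤ volume (T ∩ closedBall p r)) : IsDispersedAt S p :=
  tendsto_of_tendsto_of_tendsto_of_le_of_le tendsto_const_nhds hT (fun _ => zero_le)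
    fun r => ENNReal.div_le_div_right (h r) _

theorem IsDispersedAt.mono (hT : IsDispersedAt T p) (h : S ⊆ T) : IsDispersedAt S p :=
  hT.of_eventually_le fun _ => measure_mono (inter_subset_inter_left _ h)

theorem IsDispersedAt.union (hS : IsDispersedAt S p) (hT : IsDispersedAt T p) :
    IsDispersedAt (S ∪ T) p := by
  have h := Tendsto.add hS hT
  rw [add_zero] at h
  refine tendsto_of_tendsto_of_tendsto_of_le_of_le tendsto_const_nhds h (fun _ => zero_le)
    fun r => ?_
  simp only [← ENNReal.add_div, union_inter_distrib_right]
  exact ENNReal.div_le_div_right (measure_union_le _ _) _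

theorem isDispersedAt_of_measure_zero (h : volume S = 0) (p : ℝ) : IsDispersedAt S p := by
  have h0 : ∀ r, volume (S ∩ closedBall p r) = 0 := fun r => measure_mono_null inter_subset_left h
  simp only [IsDispersedAt, h0, ENNReal.zero_div]
  exact tendsto_const_nhds

theorem volume_closedBall_ne_zero {r : ℝ} (hr : 0 < r) : volume (closedBall p r) ≠ 0 := by
  simp [Real.volume_closedBall, hr]

theorem volume_closedBall_ne_top (r : ℝ) : volume (closedBall p r) ≠ ∞ := by
  simp [Real.volume_closedBall, ENNReal.mul_eq_top]

theorem not_isDispersedAt_univ : ¬ IsDispersedAt univ p := by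
  intro h
  have h1 : Tendsto (fun _ : ℝ => (1 : ℝ≥0∞)) (𝓝[>] 0) (𝓝 0) := by
    refine h.congr' ?_
    filter_upwards [self_mem_nhdsWithin] with r hr
    rw [univ_inter, ENNReal.div_self (volume_closedBall_ne_zero hr) (volume_closedBall_ne_top r)]
  exact one_ne_zero (tendsto_nhds_unique tendsto_const_nhds h1)

theorem measure_ne_zero_of_isDispersedAt_compl (h : IsDispersedAt Eᶜ p) : volume E ≠ 0 := by
  intro h0
  have := h.union (isDispersedAt_of_measure_zero h0 p)
  rw [compl_union_self] at this
  exact not_isDispersedAt_univ this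

/-- Almost every point of a set is a point of outer density one. -/
theorem measure_setOf_not_tendsto_density (S : Set ℝ) :
    volume {y ∈ S | ¬ Tendsto (fun r => volume (S ∩ closedBall y r) / volume (closedBall y r))
      (𝓝[>] 0) (𝓝 1)} = 0 := by
  have h := IsUnifLocDoublingMeasure.ae_tendsto_measure_inter_div (volume : Measure ℝ) S 1
  have h' : ∀ᵐ y ∂volume.restrict S,
      Tendsto (fun r => volume (S ∩ closedBall y r) / volume (closedBall y r))
      (𝓝[>] 0) (𝓝 1) := by
    filter_upwards [h] with y hy
    refine hy (fun _ => y) (fun r => r) tendsto_id ?_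
    filter_upwards [self_mem_nhdsWithin] with r hr
    simpa using (le_of_lt hr)
  rw [ae_iff] at h'
  refine le_antisymm ((measure_mono ?_).trans ((Measure.le_restrict_apply S _).trans h'.le))
    (zero_le)
  exact fun y hy => ⟨hy.2, hy.1⟩

theorem measure_zero_of_forall_isDispersedAt (h : ∀ y ∈ S, IsDispersedAt S y) : volume S = 0 := by
  refine measure_mono_null ?_ (measure_setOf_not_tendsto_density S)
  exact fun y hy => ⟨hy, fun h1 => zero_ne_one (tendsto_nhds_unique (h y hy) h1)⟩

/-- The Lebesgue density theorem. -/
theorem measure_setOf_not_isDispersedAt_compl (hE : NullMeasurableSet E) :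
    volume {y ∈ E | ¬ IsDispersedAt Eᶜ y} = 0 := by
  refine measure_mono_null ?_ (measure_setOf_not_tendsto_density E)
  refine fun y hy => ⟨hy.1, fun h1 => hy.2 ?_⟩
  have h2 := ENNReal.Tendsto.sub (tendsto_const_nhds (x := (1 : ℝ≥0∞)) (f := 𝓝[>] (0 : ℝ))) h1
    (Or.inl ENNReal.one_ne_top)
  rw [tsub_self] at h2
  refine h2.congr' ?_
  filter_upwards [self_mem_nhdsWithin] with r hr
  have h3 := measure_inter_add_sdiff₀ (μ := volume) (closedBall y r) hE
  rw [inter_comm, sdiff_eq, inter_comm _ Eᶜ] at h3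
  have h4 : volume (E ∩ closedBall y r) / volume (closedBall y r) ≠ ∞ :=
    ENNReal.div_ne_top (ne_top_of_le_ne_top (volume_closedBall_ne_top r)
      (measure_mono inter_subset_right)) (volume_closedBall_ne_zero hr)
  refine (ENNReal.eq_sub_of_add_eq h4 ?_).symm
  rw [← ENNReal.add_div, add_comm, h3,
    ENNReal.div_self (volume_closedBall_ne_zero hr) (volume_closedBall_ne_top r)]

theorem nullMeasurableSet_of_forall_isDispersedAt (hU : ∀ p ∈ U, IsDispersedAt Uᶜ p) :
    NullMeasurableSet U := by
  set T := toMeasurable volume Uᶜ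
  have hT : ∀ p ∈ U, IsDispersedAt T p := fun p hp => (hU p hp).of_eventually_le fun r =>
    (Measure.measure_toMeasurable_inter_of_sFinite measurableSet_closedBall _).le
  have hR : volume (U ∩ T) = 0 := measure_zero_of_forall_isDispersedAt fun y hy =>
    (hT y hy.1).mono inter_subset_right
  have hUT : U = Tᶜ ∪ (U ∩ T) := by
    ext y
    have : y ∉ U → y ∈ T := fun h => subset_toMeasurable _ _ h
    simp only [mem_union, mem_compl_iff, mem_inter_iff]
    tauto
  rw [hUT]
  exact (measurableSet_toMeasurable _ _).compl.nullMeasurableSet.union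
    (NullMeasurableSet.of_null hR)

theorem exists_isClosed_subset_isDispersedAt_compl (hU : NullMeasurableSet U) (hp : p ∈ U)
    (h : IsDispersedAt Uᶜ p) : ∃ C ⊆ U, p ∈ C ∧ IsClosed C ∧ IsDispersedAt Cᶜ p := by
  set N := Uᶜ ∩ closedBall p 1
  have hNm : NullMeasurableSet N := hU.compl.inter measurableSet_closedBall.nullMeasurableSet
  have hNf : volume N ≠ ∞ :=
    ne_top_of_le_ne_top (volume_closedBall_ne_top 1) (measure_mono inter_subset_right)
  have hG : ∀ n : ℕ, ∃ G, N ⊆ G ∧ IsOpen G ∧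
      volume (G \ N) ≤ ENNReal.ofReal (((1 / 2 : ℝ) ^ n) ^ 2 * (1 / 2) ^ n) := by
    intro n
    have hδ : ENNReal.ofReal (((1 / 2 : ℝ) ^ n) ^ 2 * (1 / 2) ^ n) ≠ 0 := by
      rw [Ne, ENNReal.ofReal_eq_zero, not_le]
      positivity
    obtain ⟨G, hNG, hGo, hlt⟩ := N.exists_isOpen_lt_add hNf hδ
    exact ⟨G, hNG, hGo, (measure_sdiff_le_iff_le_add hNm hNG hNf).2 hlt.le⟩
  choose G hNG hGo hGδ using hG
  set W := ⋃ n, G n ∩ (closedBall p ((1 / 2 : ℝ) ^ n))ᶜ with hW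
  have hWo : IsOpen W := isOpen_iUnion fun n => (hGo n).inter isClosed_closedBall.isOpen_compl
  refine ⟨Wᶜ ∩ closedBall p 1, ?_, ⟨?_, by simp⟩, hWo.isClosed_compl.inter isClosed_closedBall, ?_⟩
  · rintro y ⟨hyW, hy1⟩
    by_contra hyU
    have hyp : 0 < dist y p := dist_pos.2 fun h => hyU (h ▸ hp)
    obtain ⟨n, hn⟩ := exists_pow_lt_of_lt_one hyp (by norm_num : (1 / 2 : ℝ) < 1)
    exact hyW (mem_iUnion.2 ⟨n, hNG n ⟨hyU, hy1⟩, by simpa using hn⟩)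
  · simp [hW]
  · have hlim : Tendsto (fun r : ℝ => volume (Uᶜ ∩ closedBall p r) / volume (closedBall p r)
        + ENNReal.ofReal r) (𝓝[>] 0) (𝓝 0) := by
      have := (ENNReal.continuous_ofReal.tendsto 0).mono_left
        (nhdsWithin_le_nhds (a := (0 : ℝ)) (s := Ioi 0))
      simpa using Tendsto.add h this
    refine tendsto_of_tendsto_of_tendsto_of_le_of_le' tendsto_const_nhds hlim
      (Eventually.of_forall fun _ => zero_le) ?_
    filter_upwards [Ioc_mem_nhdsGT (zero_lt_one (α := ℝ))] with r hr
    have hsub : (Wᶜ ∩ closedBall p 1)ᶜ ∩ closedBall p r ⊆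
        (Uᶜ ∩ closedBall p r) ∪ ⋃ n, {y ∈ G n \ N | (1 / 2 : ℝ) ^ n < r} := by
      rintro y ⟨hy, hyr⟩
      have hy1 : y ∈ closedBall p 1 := closedBall_subset_closedBall hr.2 hyr
      have hyW : y ∈ W := by
        by_contra hyW
        exact hy ⟨hyW, hy1⟩
      obtain ⟨n, hyG, hyn⟩ := mem_iUnion.1 hyW
      by_cases hyU : y ∈ U
      · refine Or.inr (mem_iUnion.2 ⟨n, ⟨hyG, fun h => h.1 hyU⟩, ?_⟩)
        have : (1 / 2 : ℝ) ^ n < dist y p := by simpa using hyn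
        exact this.trans_le hyr
      · exact Or.inl ⟨hyU, hyr⟩
    have hterm : ∀ n, volume {y ∈ G n \ N | (1 / 2 : ℝ) ^ n < r} ≤
        ENNReal.ofReal (r ^ 2 * (1 / 2) ^ n) := by
      intro n
      by_cases hn : (1 / 2 : ℝ) ^ n < r
      · refine (measure_mono fun y hy => hy.1).trans ((hGδ n).trans (ENNReal.ofReal_le_ofReal ?_))
        gcongr
      · simp only [hn, and_false, ofPred_false, measure_empty, zero_le]
    have hsum : volume (⋃ n, {y ∈ G n \ N | (1 / 2 : ℝ) ^ n < r}) ≤ ENNReal.ofReal (r ^ 2 * 2) := by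
      refine (measure_iUnion_le _).trans ((ENNReal.tsum_le_tsum hterm).trans ?_)
      rw [← ENNReal.ofReal_tsum_of_nonneg (fun n => by positivity)
        (summable_geometric_two.mul_left _), tsum_mul_left, tsum_geometric_two]
    calc _ ≤ (volume (Uᶜ ∩ closedBall p r) + ENNReal.ofReal (r ^ 2 * 2)) /
          volume (closedBall p r) := by
          refine ENNReal.div_le_div_right ?_ _
          exact (measure_mono hsub).trans ((measure_union_le _ _).trans (by gcongr))
      _ = _ := by
        rw [ENNReal.add_div, Real.volume_closedBall,
          ← ENNReal.ofReal_div_of_pos (by linarith [hr.1])]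
        congr 2
        have := hr.1.ne'
        field_simp

end Density

section DensityTopology

/-- The density topology on the real line. -/
@[reducible] def densityTopology : TopologicalSpace ℝ where
  IsOpen U := ∀ p ∈ U, IsDispersedAt Uᶜ p
  isOpen_univ p _ := isDispersedAt_of_measure_zero (by simp) p
  isOpen_inter U V hU hV p hp := by
    rw [compl_inter]
    exact (hU p hp.1).union (hV p hp.2)
  isOpen_sUnion S hS p := by
    rintro ⟨U, hU, hp⟩
    exact (hS U hU p hp).mono (compl_subset_compl.2 (subset_sUnion_of_mem hU))

variable {S E U : Set ℝ} {p : ℝ}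

theorem nullMeasurableSet_of_isOpen_density (hU : IsOpen[densityTopology] U) :
    NullMeasurableSet U :=
  nullMeasurableSet_of_forall_isDispersedAt hU

theorem isClosed_density_of_measure_zero (hS : volume S = 0) : IsClosed[densityTopology] S := by
  refine @IsClosed.mk _ densityTopology _ fun p _ => ?_
  rw [compl_compl]
  exact isDispersedAt_of_measure_zero hS p

theorem densityTopology_le : densityTopology ≤ (inferInstance : TopologicalSpace ℝ) := by
  intro U hU p hp
  obtain ⟨ε, hε, hball⟩ := nhds_basis_closedBall.mem_iff.1 (hU.mem_nhds hp)
  refine (tendsto_const_nhds (x := (0 : ℝ≥0∞))).congr' ?_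
  filter_upwards [Ioc_mem_nhdsGT hε] with r hr
  have : Uᶜ ∩ closedBall p r = ∅ := by
    refine eq_empty_of_forall_notMem fun y hy => hy.1 (hball ?_)
    exact closedBall_subset_closedBall hr.2 hy.2
  rw [this, measure_empty, ENNReal.zero_div]

theorem isOpen_density_setOf_isDispersedAt_compl (hE : NullMeasurableSet E) :
    IsOpen[densityTopology] {y ∈ E | IsDispersedAt Eᶜ y} := by
  intro p hp
  refine (hp.2.union (isDispersedAt_of_measure_zero
    (measure_setOf_not_isDispersedAt_compl hE) p)).mono fun y hy => ?_
  by_cases hyE : y ∈ E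
  · exact Or.inr ⟨hyE, fun h => hy ⟨hyE, h⟩⟩
  · exact Or.inl hyE

theorem measure_setOf_isDispersedAt_compl_ne_zero (hE : NullMeasurableSet E)
    (h : volume E ≠ 0) : volume {y ∈ E | IsDispersedAt Eᶜ y} ≠ 0 := by
  intro h0
  refine h (measure_mono_null ?_
    (measure_union_null h0 (measure_setOf_not_isDispersedAt_compl hE)))
  intro y hy
  by_cases hd : IsDispersedAt Eᶜ y
  · exact Or.inl ⟨hy, hd⟩
  · exact Or.inr ⟨hy, hd⟩

theorem exists_isClosed_mem_nhds_density (hU : U ∈ @nhds ℝ densityTopology p) :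
    ∃ C ⊆ U, IsClosed C ∧ C ∈ @nhds ℝ densityTopology p := by
  obtain ⟨V, hVU, hV, hp⟩ := (@_root_.mem_nhds_iff ℝ densityTopology p U).1 hU
  obtain ⟨C, hCV, hpC, hC, hd⟩ := exists_isClosed_subset_isDispersedAt_compl
    (nullMeasurableSet_of_isOpen_density hV) hp (hV p hp)
  refine ⟨C, hCV.trans hVU, hC, (@_root_.mem_nhds_iff ℝ densityTopology p C).2 ⟨_, fun y hy => hy.1,
    isOpen_density_setOf_isDispersedAt_compl hC.measurableSet.nullMeasurableSet, hpC, hd⟩⟩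

theorem regularSpace_densityTopology : @RegularSpace ℝ densityTopology := by
  refine @RegularSpace.of_exists_mem_nhds_isClosed_subset ℝ densityTopology fun p U hU => ?_
  obtain ⟨C, hCU, hC, hp⟩ := exists_isClosed_mem_nhds_density hU
  exact ⟨C, hp, hC.mono densityTopology_le, hCU⟩

theorem exists_isClosed_subset_measure_ne_zero (hU : IsOpen[densityTopology] U)
    (hne : U.Nonempty) : ∃ C ⊆ U, IsClosed C ∧ volume C ≠ 0 := by
  obtain ⟨p, hp⟩ := hne
  obtain ⟨C, hCU, -, hC, hd⟩ := exists_isClosed_subset_isDispersedAt_compl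
    (nullMeasurableSet_of_isOpen_density hU) hp (hU p hp)
  exact ⟨C, hCU, hC, measure_ne_zero_of_isDispersedAt_compl hd⟩

/-- Any union of density-open sets agrees, up to a null set, with a countable subunion. -/
theorem exists_countable_measure_iUnion_sdiff_eq_zero {ι : Type*} {V : ι → Set ℝ}
    (hV : ∀ i, IsOpen[densityTopology] (V i)) :
    ∃ J : Set ι, J.Countable ∧ volume ((⋃ i, V i) \ ⋃ i ∈ J, V i) = 0 := by
  set μ := (volume : Measure ℝ).toFinite
  set φ : {J : Set ι // J.Countable} → ℝ≥0∞ := fun J => μ (⋃ i ∈ J.1, V i)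
  obtain ⟨u, -, hu, hmem⟩ := exists_seq_tendsto_sSup (S := range φ)
    ⟨_, mem_range_self ⟨∅, countable_empty⟩⟩ (OrderTop.bddAbove _)
  choose J hJ using hmem
  have hJ₀ : (⋃ n, (J n).1).Countable := countable_iUnion fun n => (J n).2
  set J₀ := ⋃ n, (J n).1
  have hmax : ∀ K, φ K ≤ φ ⟨J₀, hJ₀⟩ := fun K =>
    (le_sSup (mem_range_self K)).trans <| le_of_tendsto' hu fun n => by
      rw [← hJ n]
      exact measure_mono (biUnion_subset_biUnion_left (subset_iUnion (fun n => (J n).1) n))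
  have hnull : ∀ i, volume (V i \ ⋃ j ∈ J₀, V j) = 0 := by
    intro i
    refine absolutelyContinuous_toFinite volume ?_
    have hm : NullMeasurableSet (⋃ j ∈ J₀, V j) μ :=
      (NullMeasurableSet.biUnion hJ₀ fun j _ => nullMeasurableSet_of_isOpen_density (hV j)).mono_ac
        (toFinite_absolutelyContinuous volume)
    have hle := hmax ⟨insert i J₀, hJ₀.insert i⟩
    have h0 := (measure_sdiff_le_iff_le_add (ε := 0) hm
      (biUnion_subset_biUnion_left (subset_insert i J₀)) (measure_ne_top μ _)).2
      (by simpa only [add_zero] using hle)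
    refine measure_mono_null (sdiff_subset_sdiff_left ?_) (le_antisymm h0 zero_le)
    exact subset_biUnion_of_mem (u := V) (mem_insert i J₀)
  refine ⟨J₀, hJ₀, measure_zero_of_forall_isDispersedAt ?_⟩
  rintro y ⟨hy, -⟩
  obtain ⟨i, hi⟩ := mem_iUnion.1 hy
  refine ((hV i y hi).union (isDispersedAt_of_measure_zero (hnull i) y)).mono fun z hz => ?_
  by_cases hzi : z ∈ V i
  · exact Or.inr ⟨hzi, hz.2⟩
  · exact Or.inl hzi

end DensityTopology

section Sierpinski

theorem mk_measurableSet_real_le : #{t : Set ℝ // MeasurableSet t} ≤ 𝔠 := by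
  have h := MeasurableSpace.cardinal_measurableSet_le_continuum
    (s := MeasurableSpace.countableGeneratingSet ℝ)
    ((MeasurableSpace.countable_countableGeneratingSet (α := ℝ)).le_aleph0.trans
      aleph0_le_continuum)
  rwa [MeasurableSpace.generateFrom_countableGeneratingSet] at h

theorem exists_surjective_of_mk_le {α β : Type} [Nonempty β] (h : #β ≤ #α) :
    ∃ f : α → β, Function.Surjective f := by
  obtain ⟨e⟩ := h
  exact ⟨Function.invFun e, Function.invFun_surjective e.injective⟩

/-- Under CH there is a Sierpiński set, split in two pieces that both meet every measurable set
of positive measure. -/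
theorem exists_sierpinski_set (CH : (𝔠 : Cardinal.{0}) = ℵ₁) :
    ∃ (I : Type) (x : I → ℝ) (A : Set I), #I = ℵ₁ ∧ Function.Injective x ∧
      (∀ M, volume M = 0 → (x ⁻¹' M).Countable) ∧
      ∀ P, MeasurableSet P → volume P ≠ 0 → (∃ i ∈ A, x i ∈ P) ∧ ∃ i ∉ A, x i ∈ P := by
  let I : Type := (ℵ₁ : Cardinal.{0}).ord.ToType
  have hI : #I = ℵ₁ := mk_ord_toType _
  have hIic : ∀ i : I, (Iic i).Countable := fun i => by
    have h := mk_Iic_lt i (by simp [I]) (by rw [hI]; exact aleph0_le_aleph 1)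
    have h' : #(Iic i) < Order.succ ℵ₀ := by
      rw [succ_aleph0]
      exact h.trans_eq hI
    exact le_aleph0_iff_set_countable.1 (Order.lt_succ_iff.1 h')
  let Y := {t : Set ℝ // MeasurableSet t ∧ volume t ≠ 0}
  let Z := {t : Set ℝ // MeasurableSet t ∧ volume t = 0}
  have hY : #Y ≤ 𝔠 := (mk_subtype_le_of_subset fun _ h => h.1).trans mk_measurableSet_real_le
  have hZ : #Z ≤ 𝔠 := (mk_subtype_le_of_subset fun _ h => h.1).trans mk_measurableSet_real_le
  have : Nonempty Y := ⟨univ, MeasurableSet.univ, by simp⟩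
  have : Nonempty Z := ⟨∅, MeasurableSet.empty, by simp⟩
  obtain ⟨P, hP⟩ : ∃ P : I → Y × Bool, Function.Surjective P := by
    refine exists_surjective_of_mk_le ?_
    rw [hI, ← CH, mk_prod, Cardinal.lift_id, Cardinal.lift_id]
    refine mul_le_of_le aleph0_le_continuum hY ?_
    exact (mk_le_aleph0 (α := Bool)).trans aleph0_le_continuum
  obtain ⟨N, hN⟩ : ∃ N : I → Z, Function.Surjective N :=
    exists_surjective_of_mk_le (by rwa [hI, ← CH])
  have hex : ∀ (i : I) (f : ∀ j, j < i → ℝ), ∃ y ∈ (P i).1.1,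
      ∀ j (hj : j < i), y ∉ (N j).1 ∧ y ≠ f j hj := by
    intro i f
    have hc : (Iio i).Countable := (hIic i).mono Iio_subset_Iic_self
    have : Countable (Iio i) := hc.to_subtype
    have h0 : volume (⋃ j : Iio i, ((N j).1 ∪ {f j j.2})) = 0 :=
      measure_iUnion_null fun j => measure_union_null (N j).2.2 (by simp)
    obtain ⟨y, hy, hy'⟩ : ((P i).1.1 \ ⋃ j : Iio i, ((N j).1 ∪ {f j j.2})).Nonempty :=
      nonempty_of_measure_ne_zero (μ := volume) (by
        rw [measure_sdiff_null h0]
        exact (P i).1.2.2)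
    refine ⟨y, hy, fun j hj => ⟨fun h => hy' ?_, fun h => hy' ?_⟩⟩
    · exact mem_iUnion.2 ⟨⟨j, hj⟩, Or.inl h⟩
    · exact mem_iUnion.2 ⟨⟨j, hj⟩, Or.inr h⟩
  let x : I → ℝ := (wellFounded_lt (α := I)).fix fun i f => (hex i f).choose
  have hx : ∀ i, x i ∈ (P i).1.1 ∧ ∀ j < i, x i ∉ (N j).1 ∧ x i ≠ x j := by
    intro i
    have h := (hex i fun j _ => x j).choose_spec
    have hxi : x i = (hex i fun j _ => x j).choose := WellFounded.fix_eq _ _ _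
    rwa [← hxi] at h
  refine ⟨I, x, {i | (P i).2 = true}, hI, ?_, ?_, ?_⟩
  · exact Function.Injective.of_lt_imp_ne fun i j hij => ((hx j).2 i hij).2.symm
  · intro M hM
    obtain ⟨j, hj⟩ := hN ⟨toMeasurable volume M, measurableSet_toMeasurable _ _,
      by rwa [measure_toMeasurable]⟩
    refine (hIic j).mono fun i hi => not_lt.1 fun hji => ((hx i).2 j hji).1 ?_
    rw [hj]
    exact subset_toMeasurable _ _ hi
  · intro Q hQ hQ0
    obtain ⟨i, hi⟩ := hP (⟨Q, hQ, hQ0⟩, true)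
    obtain ⟨j, hj⟩ := hP (⟨Q, hQ, hQ0⟩, false)
    refine ⟨⟨i, by simp [hi], ?_⟩, ⟨j, by simp [hj], ?_⟩⟩
    · simpa [hi] using (hx i).1
    · simpa [hj] using (hx j).1

end Sierpinski

theorem isClosed_induced_density_of_countable {I : Type*} {x : I → ℝ}
    (hx : Function.Injective x) {C : Set I} (hC : C.Countable) :
    IsClosed[densityTopology.induced x] C :=
  (@isClosed_induced_iff I ℝ densityTopology C x).2 ⟨x '' C,
    isClosed_density_of_measure_zero ((hC.image x).measure_zero volume), preimage_image_eq C hx⟩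

/-- A subspace of the density topology on a Sierpiński set which splits into two pieces, both
meeting every measurable set of positive measure, is not weakly Whyburn. -/
theorem not_isWeaklyWhyburn_induced {I : Type*} {x : I → ℝ} {A : Set I}
    (hnull : ∀ M, volume M = 0 → (x ⁻¹' M).Countable) (hx : Function.Injective x)
    (hmeet : ∀ P, MeasurableSet P → volume P ≠ 0 → (∃ i ∈ A, x i ∈ P) ∧ ∃ i ∉ A, x i ∈ P) :
    ¬ @IsWeaklyWhyburn I (densityTopology.induced x) := by
  let _ := densityTopology.induced x
  have hmeet' : ∀ V, IsOpen[densityTopology] V → V.Nonempty →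
      (∃ i ∈ A, x i ∈ V) ∧ ∃ i ∉ A, x i ∈ V := by
    intro V hV hne
    obtain ⟨C, hCV, hC, hC0⟩ := exists_isClosed_subset_measure_ne_zero hV hne
    obtain ⟨⟨i, hi, hiC⟩, j, hj, hjC⟩ := hmeet C hC.measurableSet hC0
    exact ⟨⟨i, hi, hCV hiC⟩, j, hj, hCV hjC⟩
  intro hW
  have hA : ¬ IsClosed A := by
    intro hA
    obtain ⟨V, hV, hVA⟩ := (@isOpen_induced_iff I ℝ densityTopology _ x).1 hA.isOpen_compl
    obtain ⟨-, j, hj, -⟩ := hmeet' univ (@isOpen_univ ℝ densityTopology) univ_nonempty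
    have hjV : j ∈ x ⁻¹' V := hVA ▸ hj
    obtain ⟨⟨i, hi, hiV⟩, -⟩ := hmeet' V hV ⟨_, hjV⟩
    have hiV' : i ∈ x ⁻¹' V := hiV
    rw [hVA] at hiV'
    exact hiV' hi
  obtain ⟨p, -, F, hFA, hFp⟩ := hW A hA
  set T := toMeasurable volume (x '' F) with hT
  have hTm : MeasurableSet T := measurableSet_toMeasurable _ _
  set V := {y ∈ T | IsDispersedAt Tᶜ y}
  have hV : IsOpen[densityTopology] V :=
    isOpen_density_setOf_isDispersedAt_compl hTm.nullMeasurableSet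
  have hF0 : volume (x '' F) ≠ 0 := by
    intro h0
    have hFc : IsClosed F := isClosed_induced_density_of_countable hx
      (preimage_image_eq F hx ▸ hnull _ h0)
    rw [hFc.closure_eq, Set.sdiff_self] at hFp
    exact (singleton_ne_empty p) hFp.symm
  have hV0 : volume V ≠ 0 := measure_setOf_isDispersedAt_compl_ne_zero
    hTm.nullMeasurableSet (by rwa [hT, measure_toMeasurable])
  have hVF : x ⁻¹' V ⊆ closure F := by
    intro i hi
    refine mem_closure_iff.2 fun O hO hiO => ?_
    obtain ⟨W, hW, rfl⟩ := (@isOpen_induced_iff I ℝ densityTopology _ x).1 hO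
    obtain ⟨C, hCW, hC, hC0⟩ := exists_isClosed_subset_measure_ne_zero
      (@IsOpen.inter ℝ densityTopology W V hW hV) ⟨x i, hiO, hi⟩
    have hFC : volume (x '' F ∩ C) ≠ 0 := by
      rw [← Measure.measure_toMeasurable_inter_of_sFinite hC.measurableSet, ← hT,
        inter_eq_right.2 fun y hy => (hCW hy).2.1]
      exact hC0
    obtain ⟨-, ⟨j, hj, rfl⟩, hjC⟩ := nonempty_of_measure_ne_zero hFC
    exact ⟨j, (hCW hjC).1, hj⟩
  have hVp : IsOpen[densityTopology] (V \ {x p}) :=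
    @IsOpen.sdiff ℝ V {x p} densityTopology hV (isClosed_density_of_measure_zero (by simp))
  obtain ⟨-, j, hjA, hjV⟩ := hmeet' _ hVp (nonempty_of_measure_ne_zero (μ := volume) (by
    rwa [measure_sdiff_null (by simp)]))
  have hjp : j ∈ closure F \ F := ⟨hVF hjV.1, fun h => hjA (hFA h)⟩
  rw [hFp] at hjp
  exact hjV.2 (congrArg x hjp)

theorem lindelofSpace_induced_density {I : Type*} {x : I → ℝ}
    (hnull : ∀ M, volume M = 0 → (x ⁻¹' M).Countable) :
    @LindelofSpace I (densityTopology.induced x) := by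
  let _ := densityTopology.induced x
  refine ⟨isLindelof_of_countable_subcover fun {ι} U hU hcov => ?_⟩
  choose V hV hVU using fun i => (@isOpen_induced_iff I ℝ densityTopology _ x).1 (hU i)
  obtain ⟨J, hJ, hJ0⟩ := exists_countable_measure_iUnion_sdiff_eq_zero hV
  have hR := hnull _ hJ0
  choose k hk using fun a : I => mem_iUnion.1 (hcov (mem_univ a))
  refine ⟨J ∪ k '' (x ⁻¹' ((⋃ i, V i) \ ⋃ i ∈ J, V i)), hJ.union (hR.image k), fun a _ => ?_⟩
  have hak := hk a
  rw [← hVU] at hak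
  by_cases ha : x a ∈ ⋃ i ∈ J, V i
  · obtain ⟨i, hi, hai⟩ := mem_iUnion₂.1 ha
    exact mem_iUnion₂.2 ⟨i, Or.inl hi, by rw [← hVU]; exact hai⟩
  · exact mem_iUnion₂.2 ⟨k a, Or.inr ⟨a, ⟨mem_iUnion.2 ⟨_, hak⟩, ha⟩, rfl⟩, hk a⟩

/-- [CH] There exists a regular Hausdorff Lindelöf weak P-space of cardinality ℵ₁
and character ℵ₁ which is not weakly Whyburn. -/
theorem statement4 (CH : 2 ^ Cardinal.aleph0 = Cardinal.aleph 1) :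
    ∃ (X : Type) (_ : TopologicalSpace X),
      T2Space X ∧ RegularSpace X ∧ LindelofSpace X ∧
      (∀ C : Set X, C.Countable → IsClosed C) ∧
      Cardinal.mk X = Cardinal.aleph 1 ∧
      (∀ x : X, ∃ B : Set (Set X), Cardinal.mk B ≤ Cardinal.aleph 1 ∧
        (∀ s ∈ B, s ∈ nhds x) ∧ (∀ U ∈ nhds x, ∃ s ∈ B, s ⊆ U)) ∧
      ¬ IsWeaklyWhyburn X := by
  have hCH : (𝔠 : Cardinal.{0}) = ℵ₁ := by
    rw [two_power_aleph0] at CH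
    refine lift_injective ?_
    rw [lift_continuum, lift_aleph, Ordinal.lift_one]
    exact CH
  obtain ⟨I, x, A, hI, hx, hnull, hmeet⟩ := exists_sierpinski_set hCH
  let _ : TopologicalSpace I := densityTopology.induced x
  have hreg : RegularSpace I :=
    @regularSpace_induced ℝ I densityTopology regularSpace_densityTopology x
  have hclosed : ∀ C : Set I, C.Countable → IsClosed C := fun _ hC =>
    isClosed_induced_density_of_countable hx hC
  have : T1Space I := ⟨fun a => hclosed _ (countable_singleton a)⟩
  refine ⟨I, inferInstance, inferInstance, hreg, lindelofSpace_induced_density hnull, hclosed, hI,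
    fun a => ?_, not_isWeaklyWhyburn_induced hnull hx hmeet⟩
  refine ⟨{s ∈ range fun t : {t : Set ℝ // MeasurableSet t} => x ⁻¹' t.1 | s ∈ nhds a},
    ?_, fun s hs => hs.2, fun U hU => ?_⟩
  · rw [← hCH]
    exact (mk_subtype_le_of_subset fun _ h => h.1).trans
      (mk_range_le.trans mk_measurableSet_real_le)
  · obtain ⟨V, hV, hVU⟩ := (@mem_nhds_induced ℝ I densityTopology x a U).1 hU
    obtain ⟨C, hCV, hC, hCa⟩ := exists_isClosed_mem_nhds_density hV
    exact ⟨x ⁻¹' C, ⟨⟨⟨C, hC.measurableSet⟩, rfl⟩,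
      (@mem_nhds_induced ℝ I densityTopology x a _).2 ⟨C, hCa, subset_rfl⟩⟩,
      (preimage_mono hCV).trans hVU⟩
end

section
/- Assume there exists a weak Kurepa tree, i.e. a partial order T of cardinality ℵ₁ in which the set of strict predecessors of every element is well-ordered by the order, and which has at least ℵ₂ many uncountable branches (maximal chains of uncountable cardinality). Then there exists a topological space Z which is regular Hausdorff, a P-space, has cardinality ℵ₂, and is not weakly Whyburn. -/
open Cardinal Set TopologicalSpace

/-- A weak Kurepa tree: a partial order of cardinality ℵ₁ in which the set of strict
predecessors of every element is well-ordered by the order, having at least ℵ₂ many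
uncountable branches (maximal chains of uncountable cardinality). -/
def IsWeakKurepaTree (T : Type*) [PartialOrder T] : Prop :=
  Cardinal.mk T = Cardinal.aleph 1 ∧
  (∀ t : T, IsWellOrder {s : T // s < t} (fun a b => (a : T) < (b : T))) ∧
  Cardinal.aleph 2 ≤ Cardinal.mk {c : Set T // IsMaxChain (· ≤ ·) c ∧ ¬ c.Countable}

/-! ### Well-orders of successor cardinal length -/

/-- Every family of at most `κ` elements of `W` has a strict upper bound. -/
def HasStrictBounds (κ : Cardinal.{0}) (W : Type) [LT W] : Prop :=
  ∀ (ι : Type) (f : ι → W), #ι ≤ κ → ∃ b, ∀ i, f i < b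

theorem exists_wellOrder_succ (κ : Cardinal.{0}) (hκ : ℵ₀ ≤ κ) :
    ∃ (W : Type) (_ : LinearOrder W) (_ : WellFoundedLT W) (_ : OrderBot W),
      #W = Order.succ κ ∧ HasStrictBounds κ W ∧ ∀ x : W, #(Iic x) ≤ κ := by
  have hreg := isRegular_succ hκ
  have hne : Nonempty (Order.succ κ).ord.ToType := by
    rw [← mk_ne_zero_iff, mk_ord_toType]
    exact hreg.ne_zero
  have hmax := noMaxOrder (hκ.trans (Order.le_succ κ))
  refine ⟨(Order.succ κ).ord.ToType, inferInstance, inferInstance,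
    WellFoundedLT.toOrderBot _, mk_ord_toType _, ?_, ?_⟩
  · intro ι f hι
    by_contra! h
    have hcof : IsCofinal (range f) := fun b ↦ by
      obtain ⟨i, hi⟩ := h b
      exact ⟨f i, mem_range_self i, hi⟩
    have h1 := Order.cof_le hcof
    rw [Ordinal.cof_toType, hreg.cof_ord] at h1
    exact absurd ((h1.trans mk_range_le).trans hι) (not_le.2 (Order.lt_succ κ))
  · intro x
    obtain ⟨y, hy⟩ := exists_gt x
    have h1 : #(Iio y) < Order.succ κ := by simpa using mk_Iio_lt y (by simp)
    exact (mk_le_mk_of_subset (Iic_subset_Iio.2 hy)).trans (Order.lt_succ_iff.1 h1)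

section Combinatorics

variable {W : Type} [LinearOrder W]

/-- The points closed under `g`. -/
def closurePoints (g : W → W) : Set W := {x | ∀ y < x, g y < x}

theorem closurePoints_anti {g h : W → W} (hgh : ∀ x, g x ≤ h x) :
    closurePoints h ⊆ closurePoints g :=
  fun _ hx y hy ↦ (hgh y).trans_lt (hx y hy)

theorem IsLUB.mem_closurePoints {g : W → W} {S : Set W} {x : W} (hx : IsLUB S x)
    (hS : S ⊆ closurePoints g) : x ∈ closurePoints g := fun y hy ↦ by
  obtain ⟨s, hs, hys⟩ := (lt_isLUB_iff hx).1 hy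
  exact (hS hs y hys).trans_le (hx.1 hs)

/-- A transfinite sequence of functions, indexed by a well-order with small initial segments,
increasing pointwise and dominating the image under `H` of each earlier member. -/
theorem HasStrictBounds.exists_dominating_sequence {κ μ : Cardinal.{0}}
    (hW : HasStrictBounds κ W) (hμ : μ ≤ κ) {V : Type} [LinearOrder V] [WellFoundedLT V]
    (hV : ∀ x : V, #(Iic x) ≤ μ) (H : (W → W) → W → W) :
    ∃ g : V → W → W, ∀ i, ∀ j < i, ∀ x, g j x ≤ g i x ∧ H (g j) x ≤ g i x := by
  have step : ∀ (i : V) (G : ∀ j, j < i → W → W), ∃ b : W → W,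
      ∀ x j (hj : j < i), max (G j hj x) (H (G j hj) x) < b x := fun i G ↦ by
    have h (x : W) : ∃ b, ∀ j : Iio i, max (G j j.2 x) (H (G j j.2) x) < b :=
      hW _ _ (((mk_le_mk_of_subset Iio_subset_Iic_self).trans (hV i)).trans hμ)
    choose b hb using h
    exact ⟨b, fun x j hj ↦ hb x ⟨j, hj⟩⟩
  choose B hB using step
  let g : V → W → W := (wellFounded_lt (α := V)).fix B
  refine ⟨g, fun i j hj x ↦ ?_⟩
  have hg : g i = B i fun j _ ↦ g j := (wellFounded_lt (α := V)).fix_eq B i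
  have h := hB i (fun j _ ↦ g j) x j hj
  rw [← hg] at h
  exact ⟨(le_max_left _ _).trans h.le, (le_max_right _ _).trans h.le⟩

variable [WellFoundedLT W]

theorem exists_isLUB_of_bddAbove {S : Set W} (hS : BddAbove S) : ∃ x, IsLUB S x :=
  ⟨wellFounded_lt.min _ hS, wellFounded_lt.min_mem _ hS,
    fun _ hb ↦ not_lt.1 (wellFounded_lt.not_lt_min _ hb)⟩

theorem exists_isGreatest_closurePoints [OrderBot W] (g : W → W) (a : W) :
    ∃ m, IsGreatest (closurePoints g ∩ Iic a) m := by
  obtain ⟨m, hm⟩ := exists_isLUB_of_bddAbove (S := closurePoints g ∩ Iic a) ⟨a, fun _ h ↦ h.2⟩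
  exact ⟨m, ⟨hm.mem_closurePoints inter_subset_left, hm.2 fun _ h ↦ h.2⟩, hm.1⟩

/-- The greatest closure point of `g` below `a`. -/
noncomputable def lastClosurePoint [OrderBot W] (g : W → W) (a : W) : W :=
  (exists_isGreatest_closurePoints g a).choose

theorem isGreatest_lastClosurePoint [OrderBot W] (g : W → W) (a : W) :
    IsGreatest (closurePoints g ∩ Iic a) (lastClosurePoint g a) :=
  (exists_isGreatest_closurePoints g a).choose_spec

theorem HasStrictBounds.exists_isLUB_range {κ : Cardinal.{0}} (hW : HasStrictBounds κ W)
    (hκ : ℵ₀ ≤ κ) (u : ℕ → W) : ∃ x, IsLUB (range u) x := by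
  obtain ⟨b, hb⟩ := hW ℕ u (by simpa using hκ)
  exact exists_isLUB_of_bddAbove ⟨b, by rintro _ ⟨n, rfl⟩; exact (hb n).le⟩

theorem HasStrictBounds.exists_gt_mem_closurePoints {κ : Cardinal.{0}}
    (hW : HasStrictBounds κ W) (hκ : ℵ₀ ≤ κ) (hI : ∀ x : W, #(Iic x) ≤ κ) (g : W → W) (a : W) :
    ∃ x ∈ closurePoints g, a < x := by
  have step : ∀ x, ∃ y, ∀ z : Iic x, max (g z) z < y := fun x ↦ hW _ _ (hI x)
  choose s hs using step
  obtain ⟨x, hx⟩ := hW.exists_isLUB_range hκ fun n ↦ s^[n] a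
  refine ⟨x, fun y hy ↦ ?_, ?_⟩
  · obtain ⟨_, ⟨n, rfl⟩, hn⟩ := (lt_isLUB_iff hx).1 hy
    refine ((le_max_left _ _).trans_lt (hs (s^[n] a) ⟨y, hn.le⟩)).trans_le (hx.1 ⟨n + 1, ?_⟩)
    exact Function.iterate_succ_apply' s n a
  · exact ((le_max_right _ _).trans_lt (hs a ⟨a, le_rfl⟩)).trans_le (hx.1 ⟨1, rfl⟩)

theorem HasStrictBounds.exists_strictMono_closurePoints [OrderBot W] {κ : Cardinal.{0}}
    (hW : HasStrictBounds κ W) (hκ : ℵ₀ ≤ κ) (hI : ∀ x : W, #(Iic x) ≤ κ) (g : W → W) :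
    ∃ u : ℕ → W, StrictMono u ∧ ∀ n, u n ∈ closurePoints g := by
  have hunb := hW.exists_gt_mem_closurePoints hκ hI g
  have : Nonempty (closurePoints g) := ⟨⟨_, (hunb ⊥).choose_spec.1⟩⟩
  have : NoMaxOrder (closurePoints g) := ⟨fun a ↦ by
    obtain ⟨x, hx, hax⟩ := hunb a
    exact ⟨⟨x, hx⟩, hax⟩⟩
  obtain ⟨u, hu⟩ := Nat.exists_strictMono (closurePoints g)
  exact ⟨fun n ↦ u n, fun _ _ h ↦ hu h, fun n ↦ (u n).2⟩

/-- The last closure points below a cofinal sequence of a limit of closure points contain a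
strictly increasing sequence. -/
theorem exists_strictMono_lastClosurePoint [OrderBot W] {g : W → W} {e u : ℕ → W} {δ : W}
    (he : StrictMono e) (heδ : IsLUB (range e) δ) (hu : StrictMono u)
    (hug : ∀ n, u n ∈ closurePoints g) (huδ : IsLUB (range u) δ) :
    ∃ f : ℕ → W, StrictMono f ∧ ⊥ < f 0 ∧ ∀ k, ∃ n, f k = lastClosurePoint g (e n) := by
  have hlt {v : ℕ → W} (hv : StrictMono v) (hvδ : IsLUB (range v) δ) (n : ℕ) : v n < δ :=
    (hv n.lt_succ_self).trans_le (hvδ.1 ⟨_, rfl⟩)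
  have key : ∀ y < δ, ∃ n, y < lastClosurePoint g (e n) := fun y hy ↦ by
    obtain ⟨_, ⟨k, rfl⟩, hk⟩ := (lt_isLUB_iff huδ).1 hy
    obtain ⟨_, ⟨n, rfl⟩, hn⟩ := (lt_isLUB_iff heδ).1 (hlt hu huδ k)
    exact ⟨n, hk.trans_le ((isGreatest_lastClosurePoint g (e n)).2 ⟨hug k, hn.le⟩)⟩
  let S : Set W := {x | ⊥ < x ∧ ∃ n, x = lastClosurePoint g (e n)}
  have hS : ∀ y < δ, ∃ x ∈ S, y < x := fun y hy ↦ by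
    obtain ⟨n, hn⟩ := key y hy
    exact ⟨_, ⟨bot_le.trans_lt hn, n, rfl⟩, hn⟩
  have : Nonempty S := by
    obtain ⟨x, hx, -⟩ := hS _ (hlt he heδ 0)
    exact ⟨⟨x, hx⟩⟩
  have : NoMaxOrder S := ⟨fun ⟨a, _, n, hn⟩ ↦ by
    have ha : a < δ :=
      (hn.trans_le (isGreatest_lastClosurePoint g (e n)).1.2).trans_lt (hlt he heδ n)
    obtain ⟨x, hx, hax⟩ := hS a ha
    exact ⟨⟨x, hx⟩, hax⟩⟩
  obtain ⟨f, hf⟩ := Nat.exists_strictMono S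
  exact ⟨fun n ↦ f n, fun _ _ h ↦ hf h, (f 0).2.1, fun k ↦ (f k).2.2⟩

/-- Club guessing: for some `g` and any ladder system `e`, the last closure points of `g` below
the ladders guess the closure points of every `h`. -/
theorem exists_club_guessing [OrderBot W] (hW : HasStrictBounds ℵ₁ W)
    (hI : ∀ x : W, #(Iic x) ≤ ℵ₁) (e : W → ℕ → W) :
    ∃ g : W → W, ∀ h : W → W, ∃ (δ : W) (u : ℕ → W), StrictMono u ∧ IsLUB (range u) δ ∧
      (∀ n, u n ∈ closurePoints g) ∧ ∀ n, lastClosurePoint g (e δ n) ∈ closurePoints h := by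
  by_contra! hcon
  choose H hH using hcon
  obtain ⟨V, _, _, _, hVc, hVb, hVI⟩ := exists_wellOrder_succ ℵ₀ le_rfl
  rw [succ_aleph0] at hVc
  obtain ⟨g, hg⟩ := hW.exists_dominating_sequence aleph0_lt_aleph_one.le hVI H
  have hsup (x : W) : ∃ b, ∀ i, g i x < b := hW V (fun i ↦ g i x) hVc.le
  choose G hG using hsup
  obtain ⟨u, hu, huG⟩ := hW.exists_strictMono_closurePoints aleph0_lt_aleph_one.le hI G
  obtain ⟨δ, hδ⟩ := hW.exists_isLUB_range aleph0_lt_aleph_one.le u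
  have hanti {i j : V} (hij : i ≤ j) : closurePoints (g j) ⊆ closurePoints (g i) := by
    rcases hij.eq_or_lt with rfl | hij
    · rfl
    · exact closurePoints_anti fun x ↦ (hg j i hij x).1
  have hlast {i j : V} (hij : i ≤ j) (a : W) :
      lastClosurePoint (g j) a ≤ lastClosurePoint (g i) a :=
    (isGreatest_lastClosurePoint (g i) a).2
      (inter_subset_inter_left _ (hanti hij) (isGreatest_lastClosurePoint (g j) a).1)
  have hstab (n : ℕ) : ∃ i, ∀ j,
      lastClosurePoint (g i) (e δ n) ≤ lastClosurePoint (g j) (e δ n) := by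
    obtain ⟨_, ⟨i, rfl⟩, hi⟩ := wellFounded_lt.has_min
      (range fun i ↦ lastClosurePoint (g i) (e δ n)) ⟨_, ⟨⊥, rfl⟩⟩
    exact ⟨i, fun j ↦ not_lt.1 (hi _ ⟨j, rfl⟩)⟩
  choose I hIm using hstab
  obtain ⟨i, hi⟩ := hVb ℕ I (by simp)
  obtain ⟨k, hk⟩ := hVb Unit (fun _ ↦ i) (by simp)
  have hik : i < k := hk ()
  obtain ⟨n, hn⟩ := hH (g i) δ u hu hδ fun n ↦ closurePoints_anti (fun x ↦ (hG x i).le) (huG n)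
  refine hn (closurePoints_anti (fun x ↦ (hg k i hik x).2) ?_)
  have heq : lastClosurePoint (g i) (e δ n) = lastClosurePoint (g k) (e δ n) :=
    le_antisymm ((hlast (hi n).le _).trans (hIm n k)) (hlast hik.le _)
  rw [heq]
  exact (isGreatest_lastClosurePoint (g k) _).1.1

/-- There is a family of sequences indexed by `W` such that every strategy bounding the next entry
in terms of the previous ones is beaten at every step by some member of the family. -/
theorem exists_sequences_beating_strategies [OrderBot W] (hW : HasStrictBounds ℵ₁ W)
    (hI : ∀ x : W, #(Iic x) ≤ ℵ₁) :
    ∃ f : W → ℕ → W, ∀ c : List W → W, ∃ δ, ∀ n, c ((List.range n).map (f δ)) < f δ n := by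
  classical
  have hladder (δ : W) : ∃ e : ℕ → W, (∃ u : ℕ → W, StrictMono u ∧ IsLUB (range u) δ) →
      StrictMono e ∧ IsLUB (range e) δ := by
    by_cases h : ∃ u : ℕ → W, StrictMono u ∧ IsLUB (range u) δ
    · exact ⟨h.choose, fun _ ↦ h.choose_spec⟩
    · exact ⟨fun _ ↦ ⊥, fun h' ↦ absurd h' h⟩
  choose e he using hladder
  obtain ⟨g, hg⟩ := exists_club_guessing hW hI e
  have hthin (δ : W) : ∃ f : ℕ → W,
      (∃ u : ℕ → W, StrictMono u ∧ IsLUB (range u) δ ∧ ∀ n, u n ∈ closurePoints g) →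
      StrictMono f ∧ ⊥ < f 0 ∧ ∀ k, ∃ n, f k = lastClosurePoint g (e δ n) := by
    by_cases h : ∃ u : ℕ → W, StrictMono u ∧ IsLUB (range u) δ ∧ ∀ n, u n ∈ closurePoints g
    · obtain ⟨u, hu, huδ, hug⟩ := h
      obtain ⟨he1, he2⟩ := he δ ⟨u, hu, huδ⟩
      obtain ⟨f, hf⟩ := exists_strictMono_lastClosurePoint he1 he2 hu hug huδ
      exact ⟨f, fun _ ↦ hf⟩
    · exact ⟨fun _ ↦ ⊥, fun h' ↦ absurd h' h⟩
  choose f hf using hthin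
  refine ⟨f, fun c ↦ ?_⟩
  have hbound (y : W) : ∃ b, ∀ s : List (Iic y), c (s.map (↑)) < b :=
    hW _ _ ((mk_list_le_max _).trans (max_le aleph0_lt_aleph_one.le (hI y)))
  choose h hh using hbound
  have hlt (y : W) (s : List W) (hs : ∀ a ∈ s, a ≤ y) : c s < h y := by
    lift s to List (Iic y) using hs
    exact hh y s
  obtain ⟨δ, u, hu, huδ, hug, hδ⟩ := hg h
  obtain ⟨hmono, hpos, hmem⟩ := hf δ ⟨u, hu, huδ, hug⟩
  have hcl (k : ℕ) : f δ k ∈ closurePoints h := by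
    obtain ⟨n, hn⟩ := hmem k
    exact hn ▸ hδ n
  refine ⟨δ, fun n ↦ ?_⟩
  cases n with
  | zero => exact (hlt ⊥ _ (by simp)).trans (hcl 0 _ hpos)
  | succ n =>
    refine (hlt (f δ n) _ fun a ha ↦ ?_).trans (hcl (n + 1) _ (hmono n.lt_succ_self))
    obtain ⟨i, hi, rfl⟩ := List.mem_map.1 ha
    exact hmono.monotone (Nat.lt_succ_iff.1 (List.mem_range.1 hi))

end Combinatorics

/-! ### The tree space -/

section TreeSpace

variable {W : Type}

/-- The finite sequences in `W` together with the infinite sequences listed by `f`. -/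
inductive TreeSpace (f : W → ℕ → W) : Type
  | node (s : List W)
  | branch (δ : W)

namespace TreeSpace

variable {f : W → ℕ → W}

/-- The finite initial segments of a point. -/
def initials : TreeSpace f → Set (List W)
  | node t => {s | s <+: t}
  | branch δ => {s | ∃ n, s = (List.range n).map (f δ)}

theorem map_range_prefix (h : ℕ → W) {m n : ℕ} (hmn : m ≤ n) :
    (List.range m).map h <+: (List.range n).map h := by
  refine List.IsPrefix.map h ?_
  obtain ⟨k, rfl⟩ := Nat.exists_eq_add_of_le hmn
  rw [List.range_add]
  exact List.prefix_append _ _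

theorem initials_of_prefix {z : TreeSpace f} {s t : List W} (hst : s <+: t)
    (ht : t ∈ initials z) : s ∈ initials z := by
  cases z with
  | node u => exact hst.trans ht
  | branch δ =>
    obtain ⟨n, rfl⟩ := ht
    refine ⟨s.length, ?_⟩
    have hle : s.length ≤ n := by simpa using hst.length_le
    exact (List.prefix_of_prefix_length_le hst (map_range_prefix (f δ) hle) (by simp)).eq_of_length
      (by simp)

theorem initials_total {z : TreeSpace f} {s t : List W} (hs : s ∈ initials z)
    (ht : t ∈ initials z) : s <+: t ∨ t <+: s := by
  cases z with
  | node u => exact List.prefix_or_prefix_of_prefix hs ht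
  | branch δ =>
    obtain ⟨m, rfl⟩ := hs
    obtain ⟨n, rfl⟩ := ht
    exact (le_total m n).imp (map_range_prefix _) (map_range_prefix _)

theorem exists_append_prefix {s t : List W} (h : s <+: t) (hne : s ≠ t) :
    ∃ a ∈ t, s ++ [a] <+: t := by
  obtain ⟨r, rfl⟩ := h
  cases r with
  | nil => simp at hne
  | cons a r => exact ⟨a, by simp, r, by simp⟩

theorem exists_append_mem_initials {z : TreeSpace f} {s : List W} (hs : s ∈ initials z)
    (hz : z ≠ node s) : ∃ a, s ++ [a] ∈ initials z := by
  cases z with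
  | node t =>
    obtain ⟨a, -, ha⟩ := exists_append_prefix hs fun h ↦ hz (h ▸ rfl)
    exact ⟨a, ha⟩
  | branch δ =>
    obtain ⟨n, rfl⟩ := hs
    exact ⟨f δ n, n + 1, by simp [List.range_succ]⟩

theorem mk_eq [Infinite W] : #(TreeSpace f) = #W := by
  let φ : TreeSpace f ≃ List W ⊕ W :=
    { toFun := fun z ↦ match z with
        | node s => .inl s
        | branch δ => .inr δ
      invFun := Sum.elim node branch
      left_inv := fun z ↦ by cases z <;> rfl
      right_inv := fun z ↦ by cases z <;> rfl }
  rw [mk_congr φ, mk_sum, lift_id, lift_id, mk_list_eq_mk, add_eq_self (aleph0_le_mk W)]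

variable [LinearOrder W]

/-- The points above `s` each of whose steps past `s` exceeds the bound prescribed by `c`. -/
def cone (f : W → ℕ → W) (s : List W) (c : List W → W) : Set (TreeSpace f) :=
  {z | s ∈ initials z ∧ ∀ t a, s <+: t → t ++ [a] ∈ initials z → c t < a}

theorem node_mem_cone (s : List W) (c : List W → W) : node s ∈ cone f s c := by
  refine ⟨List.prefix_refl s, fun t a hst hta ↦ ?_⟩
  have h1 := List.IsPrefix.length_le hta
  have h2 := hst.length_le
  simp only [List.length_append, List.length_singleton] at h1
  omega

theorem cone_subset_cone {s t : List W} {c : List W → W} (h : node t ∈ cone f s c) :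
    cone f t c ⊆ cone f s c := by
  intro z hz
  refine ⟨initials_of_prefix h.1 hz.1, fun u a hsu hua ↦ ?_⟩
  rcases initials_total hz.1 hua with htu | hut
  · by_cases he : t = u ++ [a]
    · exact h.2 u a hsu (he ▸ List.prefix_refl t)
    · refine hz.2 u a ?_ hua
      rcases List.prefix_concat_iff.1 htu with h' | h'
      · exact absurd h' he
      · exact h'
  · exact h.2 u a hsu hut

theorem cone_anti {s : List W} {c d : List W → W} (h : ∀ t, c t ≤ d t) :
    cone f s d ⊆ cone f s c :=
  fun _ hz ↦ ⟨hz.1, fun t a hst hta ↦ (h t).trans_lt (hz.2 t a hst hta)⟩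

variable [OrderBot W]

instance : TopologicalSpace (TreeSpace f) where
  IsOpen U := ∀ s, node s ∈ U → ∃ c, cone f s c ⊆ U
  isOpen_univ _ _ := ⟨fun _ ↦ ⊥, subset_univ _⟩
  isOpen_inter U V hU hV s hs := by
    obtain ⟨c, hc⟩ := hU s hs.1
    obtain ⟨d, hd⟩ := hV s hs.2
    exact ⟨fun t ↦ max (c t) (d t), subset_inter
      ((cone_anti fun _ ↦ le_max_left _ _).trans hc) ((cone_anti fun _ ↦ le_max_right _ _).trans hd)⟩
  isOpen_sUnion S hS s hs := by
    obtain ⟨U, hU, hsU⟩ := hs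
    obtain ⟨c, hc⟩ := hS U hU s hsU
    exact ⟨c, hc.trans (subset_sUnion_of_mem hU)⟩

theorem isOpen_cone (s : List W) (c : List W → W) : IsOpen (cone f s c) :=
  fun _ ht ↦ ⟨c, cone_subset_cone ht⟩

theorem exists_ge_list (s : List W) : ∃ b, ∀ a ∈ s, a ≤ b := by
  induction s with
  | nil => exact ⟨⊥, by simp⟩
  | cons a s ih =>
    obtain ⟨b, hb⟩ := ih
    refine ⟨max a b, fun x hx ↦ ?_⟩
    rcases List.mem_cons.1 hx with rfl | hx
    · exact le_max_left _ _
    · exact (hb x hx).trans (le_max_right _ _)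

theorem isClosed_cone (s : List W) (c : List W → W) : IsClosed (cone f s c) := by
  refine ⟨fun t ht ↦ ?_⟩
  by_cases hst : s <+: t
  · have : ∃ u a, s <+: u ∧ u ++ [a] <+: t ∧ ¬ c u < a := by
      by_contra! h
      exact ht ⟨hst, fun u a hu ha ↦ h u a hu ha⟩
    obtain ⟨u, a, hsu, hut, ha⟩ := this
    exact ⟨c, fun z hz hz' ↦ ha (hz'.2 u a hsu (initials_of_prefix hut hz.1))⟩
  · obtain ⟨b, hb⟩ := exists_ge_list s
    refine ⟨fun _ ↦ b, fun z hz hz' ↦ ?_⟩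
    rcases initials_total hz.1 hz'.1 with h | h
    · obtain ⟨a, has, ha⟩ := exists_append_prefix h fun he ↦ hst (he ▸ List.prefix_refl _)
      exact (hz.2 t a (List.prefix_refl t) (initials_of_prefix ha hz'.1)).not_ge (hb a has)
    · exact hst h

theorem isOpen_singleton_branch (δ : W) : IsOpen {(branch δ : TreeSpace f)} :=
  fun s hs ↦ by cases hs

instance : T1Space (TreeSpace f) where
  t1 z := ⟨fun s hs ↦ by
    by_cases hsz : s ∈ initials z
    · obtain ⟨a, ha⟩ := exists_append_mem_initials hsz fun h ↦ hs h.symm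
      refine ⟨fun _ ↦ a, fun y hy hyz ↦ ?_⟩
      obtain rfl : y = z := hyz
      exact lt_irrefl a (hy.2 s a (List.prefix_refl s) ha)
    · refine ⟨fun _ ↦ ⊥, fun y hy hyz ↦ hsz ?_⟩
      obtain rfl : y = z := hyz
      exact hy.1⟩

instance : RegularSpace (TreeSpace f) := by
  refine .of_exists_mem_nhds_isClosed_subset fun z U hU ↦ ?_
  cases z with
  | node s =>
    obtain ⟨V, hVU, hV, hsV⟩ := mem_nhds_iff.1 hU
    obtain ⟨c, hc⟩ := hV s hsV
    exact ⟨cone f s c, (isOpen_cone s c).mem_nhds (node_mem_cone s c), isClosed_cone s c,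
      hc.trans hVU⟩
  | branch δ =>
    exact ⟨{branch δ}, (isOpen_singleton_branch δ).mem_nhds rfl, isClosed_singleton,
      singleton_subset_iff.2 (mem_of_mem_nhds hU)⟩

theorem isPSpace (hW : HasStrictBounds ℵ₀ W) : IsPSpace (TreeSpace f) := by
  intro S hS hopen s hs
  have h (U : S) : ∃ c, cone f s c ⊆ U := hopen U U.2 s (hs U U.2)
  choose c hc using h
  have hb (t : List W) : ∃ b, ∀ U : S, c U t < b :=
    hW S (fun U ↦ c U t) hS.le_aleph0
  choose b hb using hb
  exact ⟨b, subset_sInter fun U hU ↦ (cone_anti fun t ↦ (hb t ⟨U, hU⟩).le).trans (hc ⟨U, hU⟩)⟩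

theorem mem_closure_iff_cone {s : List W} {A : Set (TreeSpace f)} :
    node s ∈ closure A ↔ ∀ c, (cone f s c ∩ A).Nonempty := by
  rw [mem_closure_iff]
  constructor
  · exact fun h c ↦ h _ (isOpen_cone s c) (node_mem_cone s c)
  · intro h U hU hs
    obtain ⟨c, hc⟩ := hU s hs
    exact (h c).mono (inter_subset_inter_left _ hc)

theorem exists_append_mem_closure {s : List W} {F : Set (TreeSpace f)}
    (hF : F ⊆ range branch) (hs : node s ∈ closure F) : ∃ a, node (s ++ [a]) ∈ closure F := by
  classical
  by_contra! h
  simp only [mem_closure_iff_cone, not_forall, not_nonempty_iff_eq_empty] at h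
  choose c hc using h
  let d : List W → W := fun t ↦
    if ht : ∃ a, s ++ [a] <+: t then c ht.choose t else ⊥
  obtain ⟨z, hz, hzF⟩ := mem_closure_iff_cone.1 hs d
  obtain ⟨δ, rfl⟩ := hF hzF
  obtain ⟨a, ha⟩ := exists_append_mem_initials hz.1 (by simp)
  refine (hc a).subset (⟨⟨ha, fun t b hat htb ↦ ?_⟩, hzF⟩ : branch δ ∈ cone f (s ++ [a]) (c a) ∩ F)
  have hex : ∃ a, s ++ [a] <+: t := ⟨a, hat⟩
  have hch : hex.choose = a := by
    have := List.prefix_of_prefix_length_le hex.choose_spec hat (by simp)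
    simpa using this.eq_of_length (by simp)
  have := hz.2 t b ((List.prefix_append _ _).trans hat) htb
  simp only [d, dif_pos hex] at this
  rwa [hch] at this

theorem not_isWeaklyWhyburn
    (hf : ∀ c : List W → W, ∃ δ, ∀ n, c ((List.range n).map (f δ)) < f δ n) :
    ¬ IsWeaklyWhyburn (TreeSpace f) := by
  intro hww
  have hroot : (node [] : TreeSpace f) ∈ closure (range branch) := by
    refine mem_closure_iff_cone.2 fun c ↦ ?_
    obtain ⟨δ, hδ⟩ := hf c
    refine ⟨branch δ, ⟨⟨0, rfl⟩, fun t a _ ⟨n, hn⟩ ↦ ?_⟩, mem_range_self δ⟩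
    cases n with
    | zero => simp at hn
    | succ n =>
      rw [List.range_succ, List.map_append, List.map_singleton] at hn
      obtain ⟨rfl, ha⟩ := List.append_inj' hn rfl
      obtain rfl : a = f δ n := by simpa using ha
      exact hδ n
  obtain ⟨x, -, F, hFA, hF⟩ := hww (range branch) fun hcl ↦ by
    obtain ⟨δ, hδ⟩ := hcl.closure_subset hroot
    cases hδ
  obtain ⟨hxcl, hxF⟩ : x ∈ closure F \ F := hF ▸ rfl
  cases x with
  | branch δ =>
    obtain ⟨y, hy, hyF⟩ := mem_closure_iff.1 hxcl _ (isOpen_singleton_branch δ) rfl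
    obtain rfl : y = branch δ := hy
    exact hxF hyF
  | node s =>
    obtain ⟨a, ha⟩ := exists_append_mem_closure hFA hxcl
    have hmem : node (s ++ [a]) ∈ closure F \ F := ⟨ha, fun h ↦ by
      obtain ⟨δ, hδ⟩ := hFA h
      cases hδ⟩
    simp [hF] at hmem

end TreeSpace

end TreeSpace

/-- [wKH] If there exists a weak Kurepa tree, then there exists a regular Hausdorff
P-space of cardinality ℵ₂ which is not weakly Whyburn. -/
theorem statement5
    (wKH : ∃ (T : Type) (_ : PartialOrder T), IsWeakKurepaTree T) :
    ∃ (Z : Type) (_ : TopologicalSpace Z),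
      T2Space Z ∧ RegularSpace Z ∧ IsPSpace Z ∧
      Cardinal.mk Z = Cardinal.aleph 2 ∧ ¬ IsWeaklyWhyburn Z := by
  obtain ⟨W, _, _, _, hcard, hbd, hI⟩ := exists_wellOrder_succ ℵ₁ aleph0_lt_aleph_one.le
  have hcard2 : #W = Cardinal.aleph 2 := by
    rw [hcard, succ_aleph, one_add_one_eq_two]
  have : Infinite W := by
    rw [infinite_iff, hcard2]
    exact aleph0_le_aleph 2
  obtain ⟨f, hf⟩ := exists_sequences_beating_strategies hbd hI
  exact ⟨TreeSpace f, inferInstance, inferInstance, inferInstance,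
    TreeSpace.isPSpace fun ι g hι ↦ hbd ι g (hι.trans aleph0_lt_aleph_one.le),
    TreeSpace.mk_eq.trans hcard2, TreeSpace.not_isWeaklyWhyburn hf⟩
end

section
/- Every regular Hausdorff P-space X whose weight is at most ℵ₁ has a base of cardinality at most ℵ₁ consisting of clopen sets. -/
open Cardinal Set TopologicalSpace

/-- In a regular P-space every neighbourhood of a point contains a clopen one. -/
theorem IsPSpace.exists_isClopen_subset {X : Type*} [TopologicalSpace X] [RegularSpace X]
    (hP : IsPSpace X) {x : X} {U : Set X} (hU : IsOpen U) (hx : x ∈ U) :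
    ∃ C : Set X, IsClopen C ∧ x ∈ C ∧ C ⊆ U := by
  have step : ∀ V : {V : Set X // IsOpen V ∧ x ∈ V},
      ∃ W : {W : Set X // IsOpen W ∧ x ∈ W}, closure W.1 ⊆ V.1 := by
    rintro ⟨V, hV, hxV⟩
    obtain ⟨K, hK, hKc, hKV⟩ := exists_mem_nhds_isClosed_subset (hV.mem_nhds hxV)
    exact ⟨⟨interior K, isOpen_interior, mem_interior_iff_mem_nhds.2 hK⟩,
      (closure_minimal interior_subset hKc).trans hKV⟩
  choose f hf using step
  let V : ℕ → {V : Set X // IsOpen V ∧ x ∈ V} := fun n ↦ f^[n] ⟨U, hU, hx⟩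
  have hV : ∀ n, closure (V (n + 1)).1 ⊆ (V n).1 := fun n ↦ by
    simpa only [V, Function.iterate_succ_apply'] using hf (V n)
  have hclosed : ⋂ n, (V n).1 = ⋂ n, closure (V n).1 :=
    (iInter_mono fun _ ↦ subset_closure).antisymm
      (subset_iInter fun n ↦ (iInter_subset _ (n + 1)).trans (hV n))
  refine ⟨⋂ n, (V n).1, ⟨?_, ?_⟩, mem_iInter.2 fun n ↦ (V n).2.2, iInter_subset _ 0⟩
  · rw [hclosed]
    exact isClosed_iInter fun _ ↦ isClosed_closure
  · rw [← sInter_range]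
    exact hP _ (countable_range _) (forall_mem_range.2 fun n ↦ (V n).2.1)

/-- If the sets satisfying `p` form a base and there is a base of cardinality at most an infinite
`κ`, then at most `κ` sets satisfying `p` form a base. -/
theorem exists_isTopologicalBasis_mk_le_of_forall {X : Type*} [TopologicalSpace X]
    {p : Set X → Prop} (hp : IsTopologicalBasis {s | p s}) {κ : Cardinal} (hκ : ℵ₀ ≤ κ)
    {B : Set (Set X)} (hB : IsTopologicalBasis B) (hBκ : Cardinal.mk B ≤ κ) :
    ∃ B' : Set (Set X), IsTopologicalBasis B' ∧ Cardinal.mk B' ≤ κ ∧ ∀ s ∈ B', p s := by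
  let I := {q : B × B // ∃ C, p C ∧ q.1.1 ⊆ C ∧ C ⊆ q.2.1}
  choose c hcp hc₁ hc₂ using fun q : I ↦ q.2
  refine ⟨range c, ?_, ?_, forall_mem_range.2 hcp⟩
  · refine isTopologicalBasis_of_isOpen_of_nhds
      (forall_mem_range.2 fun q ↦ hp.isOpen (hcp q)) fun x U hx hU ↦ ?_
    obtain ⟨B₂, hB₂, hxB₂, hB₂U⟩ := hB.exists_subset_of_mem_open hx hU
    obtain ⟨C, hC, hxC, hCB₂⟩ := hp.exists_subset_of_mem_open hxB₂ (hB.isOpen hB₂)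
    obtain ⟨B₁, hB₁, hxB₁, hB₁C⟩ := hB.exists_subset_of_mem_open hxC (hp.isOpen hC)
    let q : I := ⟨(⟨B₁, hB₁⟩, ⟨B₂, hB₂⟩), C, hC, hB₁C, hCB₂⟩
    exact ⟨c q, mem_range_self q, hc₁ q hxB₁, (hc₂ q).trans hB₂U⟩
  · calc Cardinal.mk (range c) ≤ Cardinal.mk I := mk_range_le
      _ ≤ Cardinal.mk (B × B) := mk_subtype_le _
      _ = Cardinal.mk B * Cardinal.mk B := by simp
      _ ≤ κ * κ := mul_le_mul' hBκ hBκ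
      _ = κ := mul_eq_self hκ

/-- Every regular Hausdorff P-space of weight at most ℵ₁ has a base of cardinality
at most ℵ₁ consisting of clopen sets. -/
theorem statement6 (X : Type*) [TopologicalSpace X] [T2Space X] [RegularSpace X]
    (hP : IsPSpace X)
    (hw : ∃ B : Set (Set X), IsTopologicalBasis B ∧ Cardinal.mk B ≤ Cardinal.aleph 1) :
    ∃ B : Set (Set X), IsTopologicalBasis B ∧ Cardinal.mk B ≤ Cardinal.aleph 1 ∧
      ∀ s ∈ B, IsClopen s := by
  obtain ⟨B, hB, hBκ⟩ := hw
  refine exists_isTopologicalBasis_mk_le_of_forall ?_ (aleph0_le_aleph 1) hB hBκ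
  exact isTopologicalBasis_of_isOpen_of_nhds (fun _ hs ↦ hs.isOpen)
    fun _ _ hx hU ↦ hP.exists_isClopen_subset hU hx
end

section
/- Every Hausdorff Lindelöf weakly Whyburn P-space X of uncountable cardinality has a subspace of cardinality exactly ℵ₁ which is Lindelöf in the subspace topology. -/
open Cardinal Set TopologicalSpace

/-- In a T₁ P-space every countable set is closed. -/
theorem IsPSpace.isClosed_of_countable {X : Type*} [TopologicalSpace X] [T1Space X]
    (hP : IsPSpace X) {s : Set X} (hs : s.Countable) : IsClosed s := by
  rw [← isOpen_compl_iff]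
  have h := hP ((fun x => ({x} : Set X)ᶜ) '' s) (hs.image _) (by
    rintro _ ⟨x, -, rfl⟩
    exact isOpen_compl_singleton)
  convert h
  ext y
  simp only [mem_compl_iff, sInter_image, mem_iInter, mem_singleton_iff]
  exact ⟨fun hy x hx hyx => hy (hyx ▸ hx), fun hy hys => hy y hys rfl⟩

/-- Every Hausdorff Lindelöf weakly Whyburn P-space of uncountable cardinality has a
Lindelöf subspace of cardinality exactly ℵ₁. -/
theorem statement8 (X : Type*) [TopologicalSpace X] [T2Space X] [LindelofSpace X]
    (hww : IsWeaklyWhyburn X) (hP : IsPSpace X)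
    (hcard : Cardinal.aleph0 < Cardinal.mk X) :
    ∃ A : Set X, Cardinal.mk A = Cardinal.aleph 1 ∧ LindelofSpace A := by
  have hle : Cardinal.aleph 1 ≤ Cardinal.mk X := by
    rw [← Cardinal.succ_aleph0]
    exact Order.succ_le_of_lt hcard
  obtain ⟨A, hA⟩ := Cardinal.le_mk_iff_exists_set.1 hle
  by_cases hcl : IsClosed A
  · exact ⟨A, hA, isLindelof_iff_lindelofSpace.1 hcl.isLindelof⟩
  obtain ⟨x, -, F, hFA, hF⟩ := hww A hcl
  have hFc : ¬ F.Countable := fun h => by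
    have hx : x ∈ closure F \ F := hF ▸ mem_singleton x
    rw [(hP.isClosed_of_countable h).closure_eq] at hx
    exact hx.2 hx.1
  have hcF : closure F = insert x F := by
    rw [← sdiff_union_of_subset (subset_closure (s := F)), hF, singleton_union]
  refine ⟨closure F, le_antisymm ?_ ?_, isLindelof_iff_lindelofSpace.1 isClosed_closure.isLindelof⟩
  · rw [hcF]
    refine Cardinal.mk_insert_le.trans ?_
    refine Cardinal.add_le_of_le (Cardinal.aleph0_le_aleph 1)
      ((Cardinal.mk_le_mk_of_subset hFA).trans hA.le) ?_
    exact Cardinal.one_le_aleph0.trans (Cardinal.aleph0_le_aleph 1)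
  · rw [← Cardinal.succ_aleph0]
    refine Order.succ_le_of_lt (lt_of_not_ge fun h => hFc ?_)
    exact (Cardinal.le_aleph0_iff_set_countable.1 h).mono subset_closure
end

section
/- Assume the Continuum Hypothesis (2^{ℵ₀} = ℵ₁). Then every Hausdorff Lindelöf weakly Whyburn space X of uncountable cardinality has a subspace of cardinality exactly ℵ₁ which is Lindelöf in the subspace topology. -/
open Cardinal Set TopologicalSpace

/-- The Continuum Hypothesis does not depend on the universe in which it is stated. -/
theorem continuum_eq_aleph_one_of_continuum_eq_aleph_one.{u, v} (h : continuum.{u} = aleph.{u} 1) :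
    continuum.{v} = aleph.{v} 1 := by
  have h' := congrArg lift.{v} h
  rw [← lift_inj.{v, u}]
  simpa using h'

/-- In a type of size at least `κ`, where `κ ^ ℵ₀ = κ`, every operation on sequences admits an
invariant set of cardinality exactly `κ`. -/
theorem exists_mk_eq_forall_seq_mem {X : Type*} (f : (ℕ → X) → X) {κ : Cardinal}
    (hκ : ℵ₀ ≤ κ) (hpow : κ ^ ℵ₀ = κ) (hX : κ ≤ #X) :
    ∃ B : Set X, #B = κ ∧ ∀ s : ℕ → X, (∀ n, s n ∈ B) → f s ∈ B := by
  obtain ⟨A, hA⟩ := le_mk_iff_exists_set.mp hX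
  let β : Option A → Type := fun o => o.elim ℕ (fun _ => Empty)
  let step : (Σ o : Option A, β o → X) → X := fun p =>
    match p with
    | ⟨none, s⟩ => f s
    | ⟨some a, _⟩ => a
  let eval : WType β → X := WType.elim X step
  refine ⟨range eval, le_antisymm ?_ ?_, fun s hs => ?_⟩
  · refine mk_range_le.trans (WType.cardinalMk_le_of_le' ?_)
    have hle : ∀ o, κ ^ lift #(β o) ≤ κ := by
      rintro (_ | a)
      · simp [β, hpow]
      · simpa [β] using one_le_aleph0.trans hκ
    have hoption : #(Option A) ≤ κ := by
      rw [mk_option, hA, add_one_eq hκ]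
    refine (sum_le_sum _ _ hle).trans ?_
    rw [sum_const, lift_id, lift_id]
    exact (mul_le_mul_left hoption κ).trans (mul_eq_self hκ).le
  · rw [← hA]
    exact mk_le_mk_of_subset fun a ha => ⟨WType.mk (some ⟨a, ha⟩) Empty.elim, rfl⟩
  · choose t ht using hs
    refine ⟨WType.mk none t, ?_⟩
    change f (fun n => eval (t n)) = f s
    simp only [ht]

/-- If every almost closed countable subset of `B` converges inside `B`, and `B` has size `ℵ₁`, then
a Lindelöf weakly Whyburn space has a Lindelöf subspace of size `ℵ₁`. -/
theorem IsWeaklyWhyburn.exists_lindelofSpace {X : Type*} [TopologicalSpace X] [LindelofSpace X]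
    (hww : IsWeaklyWhyburn X) {B : Set X} (hB : #B = ℵ₁)
    (hlim : ∀ F ⊆ B, F.Countable → ∀ x, closure F \ F = {x} → x ∈ B) :
    ∃ A : Set X, #A = ℵ₁ ∧ LindelofSpace A := by
  by_cases hc : IsClosed B
  · exact ⟨B, hB, isLindelof_iff_lindelofSpace.mp hc.isLindelof⟩
  obtain ⟨x, hx, F, hFB, hF⟩ := hww B hc
  have hFunc : ¬ F.Countable := fun h => hx.2 (hlim F hFB h x hF)
  have hF1 : #F = ℵ₁ := by
    refine le_antisymm (hB ▸ mk_le_mk_of_subset hFB) ?_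
    rw [← succ_aleph0, Order.succ_le_iff, ← not_le, le_aleph0_iff_set_countable]
    exact hFunc
  have hcl : closure F = insert x F := by
    rw [← sdiff_union_of_subset (subset_closure (s := F)), hF, singleton_union]
  refine ⟨closure F, ?_, isLindelof_iff_lindelofSpace.mp isClosed_closure.isLindelof⟩
  have hxF : x ∉ F := fun h => hx.2 (hFB h)
  rw [hcl, mk_insert hxF, hF1]
  exact add_one_eq (aleph0_le_aleph 1)

/-- [CH] Every Hausdorff Lindelöf weakly Whyburn space of uncountable cardinality has
a Lindelöf subspace of cardinality exactly ℵ₁. -/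
theorem statement9 (CH : 2 ^ Cardinal.aleph0 = Cardinal.aleph 1)
    (X : Type*) [TopologicalSpace X] [T2Space X] [LindelofSpace X]
    (hww : IsWeaklyWhyburn X)
    (hcard : Cardinal.aleph0 < Cardinal.mk X) :
    ∃ A : Set X, Cardinal.mk A = Cardinal.aleph 1 ∧ LindelofSpace A := by
  classical
  have hCH : (2 : Cardinal) ^ ℵ₀ = ℵ₁ := by
    rw [two_power_aleph0] at CH ⊢
    exact continuum_eq_aleph_one_of_continuum_eq_aleph_one CH
  have hpow : ℵ₁ ^ ℵ₀ = ℵ₁ := by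
    rw [← hCH, ← power_mul, aleph0_mul_aleph0]
  have hX : ℵ₁ ≤ #X := by
    rwa [← succ_aleph0, Order.succ_le_iff]
  let f : (ℕ → X) → X := fun s =>
    if h : ∃ x, closure (range s) \ range s = {x} then h.choose else s 0
  obtain ⟨B, hB, hf⟩ := exists_mk_eq_forall_seq_mem f (aleph0_le_aleph 1) hpow hX
  refine hww.exists_lindelofSpace hB fun F hFB hFc x hx => ?_
  have hne : F.Nonempty := by
    by_contra h
    rw [not_nonempty_iff_eq_empty] at h
    simp [h] at hx
  obtain ⟨s, rfl⟩ := hFc.exists_eq_range hne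
  have hex : ∃ x, closure (range s) \ range s = {x} := ⟨x, hx⟩
  have hfs : f s = x := by
    have h := hex.choose_spec
    simp only [f, dif_pos hex]
    exact singleton_injective (h.symm.trans hx)
  exact hfs ▸ hf s fun n => hFB (mem_range_self n)
end

section
/- Every regular Hausdorff Lindelöf weakly Whyburn P-space X in which every point has pseudocharacter less than ℵ_ω (i.e. for every x ∈ X there is a family of fewer than ℵ_ω open sets whose intersection is {x}) is pseudoradial. -/
open Cardinal Set TopologicalSpace

/-- Convergence of a transfinite sequence indexed by a (well-ordered) linear order:
every neighbourhood of `x` contains a tail of the sequence. -/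
def ConvergesTo {X : Type*} [TopologicalSpace X] {ι : Type} [LinearOrder ι]
    (f : ι → X) (x : X) : Prop :=
  ∀ U ∈ nhds x, ∃ β : ι, ∀ α : ι, β ≤ α → f α ∈ U

/-- Countable extent: every closed discrete subset is countable. -/
def CountableExtent (X : Type*) [TopologicalSpace X] : Prop :=
  ∀ D : Set X, IsClosed D → DiscreteTopology D → D.Countable

/-- Pseudoradial: for every non-closed set there is a point of its closure outside it
which is the limit of a transfinite sequence of points of the set. -/
def IsPseudoradial (X : Type*) [TopologicalSpace X] : Prop :=
  ∀ A : Set X, ¬ IsClosed A → ∃ x ∈ closure A \ A,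
    ∃ (ι : Type) (_ : LinearOrder ι), IsWellOrder ι (· < ·) ∧
      ∃ f : ι → X, (∀ α, f α ∈ A) ∧ ConvergesTo f x

universe u v

open scoped Topology in
/-- In a regular Lindelöf space, if `F` is almost closed at `x`, and `x` is separated from `F` by a
family of neighbourhoods indexed by a linear order in which countable sets are bounded, but not by
its initial segments, then `x` is the limit of a transfinite sequence of points of `F`. -/
theorem exists_convergesTo_of_almostClosed {X : Type*} [TopologicalSpace X] [RegularSpace X]
    [LindelofSpace X] {ι : Type} [LinearOrder ι] (hb : ∀ C : Set ι, C.Countable → BddAbove C)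
    {F : Set X} {x : X} (hF : closure F \ F = {x}) {U : ι → Set X} (hU : ∀ i, U i ∈ 𝓝 x)
    (hUF : F ∩ ⋂ i, U i = ∅)
    (hV : ∀ V : ι → Set X, (∀ i, IsOpen (V i) ∧ x ∈ V i) → ∀ a, (F ∩ ⋂ i ≤ a, V i).Nonempty) :
    ∃ f : ι → X, (∀ i, f i ∈ F) ∧ ConvergesTo f x := by
  have hsh : ∀ i, ∃ V : Set X, (IsOpen V ∧ x ∈ V) ∧ closure V ⊆ U i := fun i => by
    obtain ⟨T, hT, hTc, hTU⟩ := exists_mem_nhds_isClosed_subset (hU i)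
    exact ⟨interior T, ⟨isOpen_interior, mem_interior_iff_mem_nhds.2 hT⟩,
      (closure_minimal interior_subset hTc).trans hTU⟩
  choose V hVo hVU using hsh
  choose f hf using hV V hVo
  refine ⟨f, fun i => (hf i).1, fun W hW => ?_⟩
  have hL : IsLindelof (closure F \ interior W) :=
    (isClosed_closure.sdiff isOpen_interior).isLindelof
  obtain ⟨r, hr, hcov⟩ := hL.elim_countable_subcover (fun i => (closure (V i))ᶜ)
    (fun i => isClosed_closure.isOpen_compl) (fun y ⟨hyF, hyW⟩ => by
      have hy : y ∈ F := by
        by_contra h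
        have hyx : y ∈ ({x} : Set X) := hF ▸ ⟨hyF, h⟩
        rw [mem_singleton_iff] at hyx
        exact hyW (hyx ▸ mem_interior_iff_mem_nhds.2 hW)
      by_contra h
      simp only [mem_iUnion, mem_compl_iff, not_exists, not_not] at h
      exact (hUF ▸ notMem_empty y) ⟨hy, mem_iInter.2 fun i => hVU i (h i)⟩)
  obtain ⟨β, hβ⟩ := hb r hr
  refine ⟨β, fun α hα => ?_⟩
  by_contra h
  obtain ⟨hfF, hfV⟩ := hf α
  have := hcov ⟨subset_closure hfF, fun h' => h (interior_subset h')⟩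
  simp only [mem_iUnion, mem_compl_iff] at this
  obtain ⟨i, hi, hi'⟩ := this
  simp only [mem_iInter] at hfV
  exact hi' (subset_closure (hfV i ((hβ hi).trans hα)))

/-- A family of at most `#ι` sets is, up to repetitions and copies of `univ`, indexed by `ι`. -/
theorem exists_indexed_family {X : Type u} {ι : Type v} {S : Set (Set X)}
    (h : lift.{v} #S ≤ lift.{u} #ι) :
    ∃ U : ι → Set X, (∀ i, U i ∈ S ∨ U i = Set.univ) ∧ ⋂ i, U i = ⋂₀ S := by
  obtain ⟨g⟩ := lift_mk_le'.1 h
  refine ⟨Function.extend g Subtype.val fun _ => Set.univ, fun i => ?_, ?_⟩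
  · by_cases hi : ∃ s, g s = i
    · obtain ⟨s, rfl⟩ := hi
      exact .inl (by rw [g.injective.extend_apply]; exact s.2)
    · exact .inr (Function.extend_apply' _ _ _ hi)
  · refine subset_antisymm (fun y hy s hs => ?_) (subset_iInter fun i => ?_)
    · simpa [g.injective.extend_apply] using mem_iInter.1 hy (g ⟨s, hs⟩)
    · by_cases hi : ∃ s, g s = i
      · obtain ⟨s, rfl⟩ := hi
        rw [g.injective.extend_apply]
        exact sInter_subset_of_mem s.2
      · rw [Function.extend_apply' _ _ _ hi]
        exact subset_univ _

theorem lt_aleph_omega0_iff {c : Cardinal.{u}} :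
    c < ℵ_ Ordinal.omega0 ↔ ∃ n : ℕ, c < ℵ_ (n : Ordinal.{u}) := by
  rw [isNormal_aleph.lt_iff_exists_lt Ordinal.isSuccLimit_omega0]
  constructor
  · rintro ⟨o, ho, hc⟩
    obtain ⟨n, rfl⟩ := Ordinal.lt_omega0.1 ho
    exact ⟨n, hc⟩
  · rintro ⟨n, hn⟩
    exact ⟨n, Ordinal.natCast_lt_omega0 n, hn⟩

theorem bddAbove_of_countable_of_aleph_add_one {o : Ordinal.{u}}
    (C : Set (ℵ_ (o + 1)).ord.ToType) (hC : C.Countable) : BddAbove C := by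
  by_contra h
  have hcof : IsCofinal C := fun a => by
    obtain ⟨b, hb, hab⟩ := not_bddAbove_iff.1 h a
    exact ⟨b, hb, hab.le⟩
  have h1 := Order.cof_le hcof
  rw [← Ordinal.cof_type, Ordinal.type_toType, (isRegular_aleph_add_one o).cof_ord] at h1
  have h2 := h1.trans (le_aleph0_iff_set_countable.2 hC)
  rw [← succ_aleph] at h2
  exact (Order.succ_le_iff.1 h2).not_ge (aleph0_le_aleph o)

/-- Every regular Hausdorff Lindelöf weakly Whyburn P-space in which every point has
pseudocharacter less than ℵ_ω is pseudoradial. -/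
theorem statement10 (X : Type*) [TopologicalSpace X] [T2Space X] [RegularSpace X]
    [LindelofSpace X] (hww : IsWeaklyWhyburn X) (hP : IsPSpace X)
    (hpsi : ∀ x : X, ∃ S : Set (Set X), (∀ s ∈ S, IsOpen s) ∧ ⋂₀ S = {x} ∧
      Cardinal.mk S < Cardinal.aleph Ordinal.omega0) :
    IsPseudoradial X := by
  intro A hA
  obtain ⟨x, hx, F, hFA, hF⟩ := hww A hA
  have hxF : x ∈ closure F \ F := hF ▸ mem_singleton x
  refine ⟨x, hx, ?_⟩
  let P : ℕ → Prop := fun n => ∃ S : Set (Set X), (∀ s ∈ S, IsOpen s ∧ x ∈ s) ∧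
    F ∩ ⋂₀ S = ∅ ∧ #S ≤ ℵ_ n
  have hex : ∃ n, P n := by
    obtain ⟨S, hSo, hSx, hS⟩ := hpsi x
    obtain ⟨n, hn⟩ := lt_aleph_omega0_iff.1 hS
    refine ⟨n, S, fun s hs => ⟨hSo s hs, ?_⟩, ?_, hn.le⟩
    · exact (hSx ▸ mem_singleton x : x ∈ ⋂₀ S) s hs
    · rw [hSx, inter_singleton_eq_empty]
      exact hxF.2
  classical
  obtain ⟨n, ⟨S, hSo, hSF, hS⟩, hmin⟩ : ∃ n, P n ∧ ∀ m < n, ¬ P m :=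
    ⟨Nat.find hex, Nat.find_spec hex, fun m => Nat.find_min hex⟩
  rcases n with _ | m
  · have hc : S.Countable := le_aleph0_iff_set_countable.1 (by simpa using hS)
    obtain ⟨y, hyS, hyF⟩ := mem_closure_iff.1 hxF.1 _ (hP S hc fun s hs => (hSo s hs).1)
      (mem_sInter.2 fun s hs => (hSo s hs).2)
    exact (hSF ▸ notMem_empty y) ⟨hyF, hyS⟩ |>.elim
  · let ι : Type := (ℵ_ ((m : Ordinal.{0}) + 1)).ord.ToType
    obtain ⟨U, hUS, hUI⟩ := exists_indexed_family (S := S) (ι := ι) (by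
      simpa [ι] using hS)
    obtain ⟨f, hfF, hfx⟩ := exists_convergesTo_of_almostClosed (ι := ι)
      bddAbove_of_countable_of_aleph_add_one hF (U := U)
      (fun i => (hUS i).elim (fun h => (hSo _ h).1.mem_nhds (hSo _ h).2)
        fun h => h ▸ Filter.univ_mem) (by rw [hUI, hSF]) (fun V hV a => by
          by_contra hne
          refine hmin m m.lt_succ_self ⟨V '' Iic a, ?_, ?_, ?_⟩
          · rintro _ ⟨i, -, rfl⟩
            exact hV i
          · rw [sInter_image]
            exact not_nonempty_iff_eq_empty.1 hne
          · have h : #(Iic a) ≤ ℵ_ m := by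
              rw [← Order.lt_succ_iff, succ_aleph]
              simpa [ι] using mk_Iic_lt a (by simp [ι]) (by simp [ι])
            simpa using mk_image_le_lift.trans (lift_le.2 h))
    exact ⟨ι, inferInstance, inferInstance, f, fun i => hFA (hfF i), hfx⟩
end

section
/- If X is a Hausdorff Whyburn P-space of countable extent (every closed discrete subset of X is countable), then X is radial of radial character ℵ₁: for every set A ⊆ X and every point x ∈ closure(A) \ A there is a transfinite sequence (x_α)_{α<κ} of points of A with κ ≤ ω₁ which converges to x. -/
open Cardinal Set TopologicalSpace

theorem IsPSpace.isClosed_sUnion {X : Type*} [TopologicalSpace X] (hP : IsPSpace X)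
    {S : Set (Set X)} (hS : S.Countable) (h : ∀ s ∈ S, IsClosed s) : IsClosed (⋃₀ S) := by
  rw [← isOpen_compl_iff, compl_sUnion]
  refine hP _ (hS.image _) ?_
  rintro _ ⟨s, hs, rfl⟩
  exact (h s hs).isOpen_compl

theorem isClosed_and_isDiscrete_of_subsingleton_inter_nhds {X : Type*} [TopologicalSpace X]
    [T1Space X] {S : Set X} (h : ∀ y, ∃ O ∈ nhds y, (O ∩ S).Subsingleton) :
    IsClosed S ∧ IsDiscrete S := by
  rw [isClosed_and_discrete_iff]
  intro y
  obtain ⟨O, hO, hsub⟩ := h y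
  rw [Filter.disjoint_principal_right, mem_nhdsWithin_iff_exists_mem_nhds_inter]
  by_cases hy : ∃ d ∈ O ∩ S, d ≠ y
  · obtain ⟨d, hd, hdy⟩ := hy
    refine ⟨O ∩ {d}ᶜ, Filter.inter_mem hO (isOpen_compl_singleton.mem_nhds hdy.symm), ?_⟩
    rintro z ⟨⟨hzO, hzd⟩, -⟩ hzS
    exact hzd (hsub ⟨hzO, hzS⟩ hd)
  · push Not at hy
    exact ⟨O, hO, fun z hz hzS => hz.2 (hy z ⟨hz.1, hzS⟩)⟩

/-- Every point in the closure of `A` but outside `A` is in the closure of the union of some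
disjoint family of relatively open subsets of `A` whose closures miss that point. -/
theorem exists_pairwiseDisjoint_relOpen_mem_closure {X : Type*} [TopologicalSpace X] [T2Space X]
    {A : Set X} {x : X} (hx : x ∈ closure A \ A) :
    ∃ V : Set (Set X), V.PairwiseDisjoint id ∧
      (∀ v ∈ V, (∃ O, IsOpen O ∧ v = O ∩ A) ∧ x ∉ closure v) ∧ x ∈ closure (⋃₀ V) := by
  obtain ⟨V, hV⟩ := zorn_subset {V : Set (Set X) | V.PairwiseDisjoint id ∧
      ∀ v ∈ V, (∃ O, IsOpen O ∧ v = O ∩ A) ∧ x ∉ closure v} (by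
    intro c hc hchain
    refine ⟨⋃₀ c, ⟨?_, ?_⟩, fun s hs => subset_sUnion_of_mem hs⟩
    · exact (pairwiseDisjoint_sUnion hchain.directedOn).2 fun s hs => (hc hs).1
    · rintro v ⟨s, hs, hv⟩
      exact (hc hs).2 v hv)
  refine ⟨V, hV.prop.1, hV.prop.2, ?_⟩
  rw [mem_closure_iff]
  intro U hU hxU
  by_contra hne
  obtain ⟨a, haU, haA⟩ := mem_closure_iff.1 hx.1 U hU hxU
  have hax : a ≠ x := by
    rintro rfl
    exact hx.2 haA
  obtain ⟨W, W', hW, hW', haW, hxW', hWW'⟩ := t2_separation hax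
  have hmem : insert (U ∩ W ∩ A) V ∈ {V : Set (Set X) | V.PairwiseDisjoint id ∧
      ∀ v ∈ V, (∃ O, IsOpen O ∧ v = O ∩ A) ∧ x ∉ closure v} := by
    refine ⟨hV.prop.1.insert ?_, ?_⟩
    · intro v hv _
      refine Set.disjoint_left.2 fun z hz hzv => hne ⟨z, hz.1.1, v, hv, hzv⟩
    · rintro v (rfl | hv)
      · refine ⟨⟨U ∩ W, hU.inter hW, rfl⟩, fun hcl => ?_⟩
        obtain ⟨z, hz, hz'⟩ := mem_closure_iff.1 hcl W' hW' hxW'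
        exact Set.disjoint_left.1 hWW' hz'.1.2 hz
      · exact hV.prop.2 v hv
  have hin := hV.le_of_ge hmem (subset_insert _ _) (mem_insert _ _)
  exact hne ⟨a, haU, _, hin, ⟨haU, haW⟩, haA⟩

/-- In a Whyburn P-space of countable extent, every point of `closure A \ A` has an uncountable
`D ⊆ A` almost contained in each of its neighbourhoods. -/
theorem IsWhyburn.exists_uncountable_subset {X : Type*} [TopologicalSpace X] [T2Space X]
    (hW : IsWhyburn X) (hP : IsPSpace X) (hext : CountableExtent X)
    {A : Set X} {x : X} (hx : x ∈ closure A \ A) :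
    ∃ D ⊆ A, ¬ D.Countable ∧ ∀ U ∈ nhds x, (D \ U).Countable := by
  obtain ⟨V, hdisj, hV, hxV⟩ := exists_pairwiseDisjoint_relOpen_mem_closure hx
  have hVA : ⋃₀ V ⊆ A := by
    rintro z ⟨v, hv, hz⟩
    obtain ⟨⟨O, -, rfl⟩, -⟩ := hV v hv
    exact hz.2
  have hxV' : x ∉ ⋃₀ V := fun h => hx.2 (hVA h)
  obtain ⟨G, hGV, hG⟩ := hW (⋃₀ V) (fun h => hxV' (h.closure_eq ▸ hxV)) x ⟨hxV, hxV'⟩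
  let T := {v ∈ V | (v ∩ G).Nonempty}
  have : Nonempty X := ⟨x⟩
  choose! p hp using fun v (hv : v ∈ T) => hv.2
  have hDA : p '' T ⊆ A := by
    rintro _ ⟨v, hv, rfl⟩
    exact hVA ⟨v, hv.1, (hp v hv).1⟩
  refine ⟨p '' T, hDA, fun hcount => ?_, fun U hU => ?_⟩
  · have hinj : InjOn p T := fun v hv w hw hvw =>
      hdisj.elim_set hv.1 hw.1 _ (hp v hv).1 (hvw ▸ (hp w hw).1)
    have hTc : T.Countable := countable_of_injective_of_countable_image hinj hcount
    have hcl : IsClosed (⋃₀ (closure '' T)) := hP.isClosed_sUnion (hTc.image _) (by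
      rintro _ ⟨v, -, rfl⟩
      exact isClosed_closure)
    have hsub : G ⊆ ⋃₀ (closure '' T) := by
      intro z hz
      obtain ⟨v, hv, hzv⟩ := hGV hz
      exact ⟨closure v, ⟨v, ⟨hv, z, hzv, hz⟩, rfl⟩, subset_closure hzv⟩
    have hxG : x ∈ closure G \ G := hG ▸ mem_singleton x
    obtain ⟨_, ⟨v, hv, rfl⟩, hxv⟩ := closure_minimal hsub hcl hxG.1
    exact (hV v hv.1).2 hxv
  · have key := isClosed_and_isDiscrete_of_subsingleton_inter_nhds (S := p '' T \ U) (by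
      intro y
      by_cases hyx : y = x
      · subst hyx
        exact ⟨U, hU, fun z hz => (hz.2.2 hz.1).elim⟩
      by_cases hyG : y ∈ closure G
      · have hyG' : y ∈ G := by
          by_contra h
          exact hyx (hG ▸ (⟨hyG, h⟩ : y ∈ closure G \ G) : y ∈ ({x} : Set X))
        obtain ⟨v, hv, hyv⟩ := hGV hyG'
        obtain ⟨⟨O, hO, hvO⟩, -⟩ := hV v hv
        have huniq : ∀ z ∈ O ∩ (p '' T \ U), z = p v := by
          rintro _ ⟨hzO, ⟨w, hw, rfl⟩, -⟩
          have hzv : p w ∈ v := hvO ▸ ⟨hzO, hDA ⟨w, hw, rfl⟩⟩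
          rw [hdisj.elim_set hw.1 hv _ (hp w hw).1 hzv]
        exact ⟨O, hO.mem_nhds (hvO ▸ hyv : y ∈ O ∩ A).1,
          fun z hz z' hz' => (huniq z hz).trans (huniq z' hz').symm⟩
      · refine ⟨(closure G)ᶜ, isClosed_closure.isOpen_compl.mem_nhds hyG, ?_⟩
        rintro _ ⟨hz, ⟨w, hw, rfl⟩, -⟩
        exact (hz (subset_closure (hp w hw).2)).elim)
    exact hext _ key.1 key.2.to_subtype

theorem exists_forall_ge_notMem_of_countable {S : Set (Cardinal.aleph 1).ord.ToType}
    (hS : S.Countable) : ∃ β, ∀ α, β ≤ α → α ∉ S := by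
  by_contra! h
  have hIic : ∀ i : (Cardinal.aleph 1).ord.ToType, (Iic i).Countable := fun i => by
    rw [← Iio_insert, countable_insert, ← Cardinal.le_aleph0_iff_set_countable,
      ← Cardinal.lt_aleph_one_iff]
    simpa using Cardinal.mk_Iio_lt i (by simp)
  have huniv : (univ : Set (Cardinal.aleph 1).ord.ToType).Countable :=
    (hS.biUnion fun i _ => hIic i).mono fun β _ => by
      obtain ⟨α, hβ, hα⟩ := h β
      exact mem_biUnion hα hβ
  rw [← Cardinal.le_aleph0_iff_set_countable, Cardinal.mk_univ, Cardinal.mk_ord_toType] at huniv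
  exact huniv.not_gt Cardinal.aleph0_lt_aleph_one

/-- Every Hausdorff Whyburn P-space of countable extent is radial of radial
character ℵ₁. -/
theorem statement11 (X : Type*) [TopologicalSpace X] [T2Space X]
    (hW : IsWhyburn X) (hP : IsPSpace X) (hext : CountableExtent X) :
    ∀ A : Set X, ∀ x ∈ closure A \ A,
      ∃ (ι : Type) (_ : LinearOrder ι), IsWellOrder ι (· < ·) ∧
        Cardinal.mk ι ≤ Cardinal.aleph 1 ∧
        ∃ f : ι → X, (∀ α, f α ∈ A) ∧ ConvergesTo f x := by
  intro A x hx
  obtain ⟨D, hDA, hD, hDU⟩ := hW.exists_uncountable_subset hP hext hx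
  have hcard : Cardinal.aleph 1 ≤ Cardinal.mk D := by
    rwa [Cardinal.aleph_one_le_iff, ← not_le, Cardinal.le_aleph0_iff_set_countable]
  obtain ⟨e⟩ : Nonempty ((Cardinal.aleph 1).ord.ToType ↪ D) := by
    rw [← Cardinal.lift_mk_le', Cardinal.mk_ord_toType]
    simpa using hcard
  refine ⟨(Cardinal.aleph 1).ord.ToType, inferInstance, inferInstance,
    (Cardinal.mk_ord_toType _).le, fun α => e α, fun α => hDA (e α).2, fun U hU => ?_⟩
  have hinj : Function.Injective fun α => (e α : X) := Subtype.val_injective.comp e.injective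
  obtain ⟨β, hβ⟩ := exists_forall_ge_notMem_of_countable ((hDU U hU).preimage hinj)
  exact ⟨β, fun α hα => by_contra fun h => hβ α hα ⟨(e α).2, h⟩⟩
end

section
/- Every Hausdorff P-space X of cardinality ℵ₁ and countable extent (every closed discrete subset of X is countable) is Lindelöf and radial: for every set A ⊆ X and every point x ∈ closure(A) \ A there is a transfinite sequence of points of A converging to x. -/
open Cardinal Set TopologicalSpace

theorem IsPSpace.isOpen_biInter {X : Type*} [TopologicalSpace X] (hP : IsPSpace X)
    {ι : Type*} {s : Set ι} (hs : s.Countable) {U : ι → Set X} (hU : ∀ i ∈ s, IsOpen (U i)) :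
    IsOpen (⋂ i ∈ s, U i) := by
  rw [← sInter_image]
  exact hP _ (hs.image U) (by rintro _ ⟨i, hi, rfl⟩; exact hU i hi)

/-- In a T₁ P-space, a set which is locally countable at every point is closed and discrete. -/
theorem IsPSpace.isClosed_and_isDiscrete {X : Type*} [TopologicalSpace X] [T1Space X]
    (hP : IsPSpace X) {D : Set X}
    (hD : ∀ y, ∃ U, IsOpen U ∧ y ∈ U ∧ (U ∩ D).Countable) :
    IsClosed D ∧ IsDiscrete D := by
  refine isClosed_and_discrete_iff.2 fun y => ?_
  obtain ⟨U, hU, hyU, hc⟩ := hD y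
  have hopen : IsOpen (U \ ((U ∩ D) \ {y})) :=
    hU.sdiff (hP.isClosed_of_countable (hc.mono sdiff_subset))
  rw [Filter.disjoint_principal_right, mem_nhdsWithin]
  exact ⟨_, hopen, ⟨hyU, fun h => h.2 rfl⟩, fun z hz hzD => hz.1.2 ⟨⟨hz.1.1, hzD⟩, hz.2⟩⟩

theorem countable_Iic_aleph_one_ord_toType (a : (aleph 1).ord.ToType) : (Iic a).Countable := by
  rw [← Iio_insert]
  refine Countable.insert a (le_aleph0_iff_set_countable.1 (lt_aleph_one_iff.1 ?_))
  simpa using mk_Iio_lt a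

theorem bddAbove_aleph_one_ord_toType {s : Set (aleph 1).ord.ToType} (hs : s.Countable) :
    BddAbove s := by
  by_contra h
  rw [not_bddAbove_iff] at h
  have hc : (univ : Set (aleph 1).ord.ToType).Countable := by
    refine (hs.biUnion fun a _ => countable_Iic_aleph_one_ord_toType a).mono fun a _ => ?_
    obtain ⟨b, hb, hab⟩ := h a
    exact mem_biUnion hb hab.le
  rw [← le_aleph0_iff_set_countable, ← lt_aleph_one_iff, mk_univ, mk_ord_toType] at hc
  exact hc.false

theorem exists_equiv_aleph_one_ord_toType {X : Type*} (hX : #X = aleph 1) :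
    Nonempty ((aleph 1).ord.ToType ≃ X) := by
  rw [← lift_mk_eq', hX, mk_ord_toType]
  simp

theorem IsPSpace.lindelofSpace_of_countableExtent {X : Type*} [TopologicalSpace X] [T1Space X]
    (hP : IsPSpace X) (hcard : #X = aleph 1) (hext : CountableExtent X) : LindelofSpace X := by
  obtain ⟨e⟩ := exists_equiv_aleph_one_ord_toType.{_, 0} hcard
  refine isLindelof_univ_iff.1 (isLindelof_of_countable_subcover fun {κ} U hU hcov => ?_)
  by_contra! hno
  have hmem : ∀ a, ∃ k, e a ∈ U k := fun a => mem_iUnion.1 (hcov (mem_univ _))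
  choose c hc using hmem
  have hpoint : ∀ a, ∃ y, ∀ b ≤ a, y ∉ U (c b) := by
    intro a
    obtain ⟨y, -, hy⟩ := not_subset.1
      (hno (c '' Iic a) ((countable_Iic_aleph_one_ord_toType a).image c))
    simp only [biUnion_image, mem_iUnion, not_exists] at hy
    exact ⟨y, hy⟩
  choose x hx using hpoint
  have hD : IsClosed (range x) ∧ IsDiscrete (range x) := by
    refine hP.isClosed_and_isDiscrete fun y => ?_
    obtain ⟨b, rfl⟩ := e.surjective y
    refine ⟨U (c b), hU _, hc b,
      ((countable_Iic_aleph_one_ord_toType b).image x).mono ?_⟩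
    rintro _ ⟨hz, a, rfl⟩
    exact ⟨a, le_of_not_ge fun hba => hx a b hba hz, rfl⟩
  have hcount : (range x).Countable := hext _ hD.1 hD.2.to_subtype
  obtain ⟨m, hm⟩ := bddAbove_aleph_one_ord_toType (hcount.image e.symm)
  refine hx m (e.symm (x m)) (hm (mem_image_of_mem _ (mem_range_self m))) ?_
  simpa using hc (e.symm (x m))

theorem IsPSpace.exists_convergesTo {X : Type*} [TopologicalSpace X] [T2Space X]
    [LindelofSpace X] (hP : IsPSpace X) (hcard : #X = aleph 1) {A : Set X} {x : X}
    (hx : x ∈ closure A) :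
    ∃ f : (aleph 1).ord.ToType → X, (∀ a, f a ∈ A) ∧ ConvergesTo f x := by
  obtain ⟨e⟩ := exists_equiv_aleph_one_ord_toType hcard
  have hsep : ∀ b, ∃ O, IsOpen O ∧ x ∈ O ∧ (e b ≠ x → e b ∉ closure O) := by
    intro b
    by_cases hb : e b = x
    · exact ⟨univ, isOpen_univ, mem_univ x, fun h => (h hb).elim⟩
    · obtain ⟨V, W, hV, hW, hbV, hxW, hVW⟩ := t2_separation hb
      exact ⟨W, hW, hxW, fun _ h => (hVW.closure_right hV).le_bot ⟨hbV, h⟩⟩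
  choose O hO hxO hOe using hsep
  have hpoint : ∀ a, ∃ y ∈ A, ∀ b ≤ a, y ∈ O b := by
    intro a
    obtain ⟨y, hy, hyA⟩ := mem_closure_iff.1 hx _
      (hP.isOpen_biInter (countable_Iic_aleph_one_ord_toType a) fun b _ => hO b)
      (mem_iInter₂.2 fun b _ => hxO b)
    exact ⟨y, hyA, mem_iInter₂.1 hy⟩
  choose f hfA hf using hpoint
  refine ⟨f, hfA, fun U hU => ?_⟩
  obtain ⟨V, hVU, hV, hxV⟩ := mem_nhds_iff.1 hU
  obtain ⟨r, hr, hcov⟩ := hV.isClosed_compl.isLindelof.elim_countable_subcover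
    (fun b => (closure (O b))ᶜ) (fun b => isClosed_closure.isOpen_compl) (by
      intro y hy
      obtain ⟨b, rfl⟩ := e.surjective y
      exact mem_iUnion.2 ⟨b, hOe b fun h => hy (h ▸ hxV)⟩)
  obtain ⟨m, hm⟩ := bddAbove_aleph_one_ord_toType hr
  refine ⟨m, fun a ha => hVU (by_contra fun hfa => ?_)⟩
  obtain ⟨b, hb, hfb⟩ := mem_iUnion₂.1 (hcov hfa)
  exact hfb (subset_closure (hf a b ((hm hb).trans ha)))

/-- Every Hausdorff P-space of cardinality ℵ₁ and countable extent is Lindelöf and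
radial. -/
theorem statement12 (X : Type*) [TopologicalSpace X] [T2Space X]
    (hP : IsPSpace X) (hcard : Cardinal.mk X = Cardinal.aleph 1)
    (hext : CountableExtent X) :
    LindelofSpace X ∧
    ∀ A : Set X, ∀ x ∈ closure A \ A,
      ∃ (ι : Type) (_ : LinearOrder ι), IsWellOrder ι (· < ·) ∧
        ∃ f : ι → X, (∀ α, f α ∈ A) ∧ ConvergesTo f x := by
  have hL : LindelofSpace X := hP.lindelofSpace_of_countableExtent hcard hext
  exact ⟨hL, fun A x hx => ⟨_, inferInstance, inferInstance, hP.exists_convergesTo hcard hx.1⟩⟩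
end

section
/- Let X be a Hausdorff Lindelöf Whyburn P-space and Y a Hausdorff Lindelöf weakly Whyburn P-space. Then the product space X × Y is weakly Whyburn. -/
open Cardinal Set TopologicalSpace

/-- Greedy construction along a well-founded relation: membership of a point may be prescribed in
terms of the members that precede it. -/
theorem WellFounded.exists_set_forall_mem_iff {α : Type*} {r : α → α → Prop} (hr : WellFounded r)
    (P : α → Set α → Prop) : ∃ T : Set α, ∀ a, a ∈ T ↔ P a {b ∈ T | r b a} := by
  refine ⟨{a | hr.fix (C := fun _ => Prop) (fun a f => P a {b | ∃ h : r b a, f b h}) a},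
    fun a => ?_⟩
  rw [mem_ofPred_eq, hr.fix_eq]
  have : {b | ∃ _ : r b a, hr.fix (C := fun _ => Prop)
      (fun a f => P a {b | ∃ h : r b a, f b h}) b} =
      {b ∈ {a | hr.fix (C := fun _ => Prop)
        (fun a f => P a {b | ∃ h : r b a, f b h}) a} | r b a} := by
    ext b
    simp [and_comm]
  rw [this]

namespace IsPSpace

variable {X : Type*} [TopologicalSpace X]

theorem isOpen_biInter_s14 (hP : IsPSpace X) {ι : Type*} {c : Set ι} (hc : c.Countable)
    {s : ι → Set X} (hs : ∀ i ∈ c, IsOpen (s i)) : IsOpen (⋂ i ∈ c, s i) := by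
  rw [← sInter_image]
  exact hP _ (hc.image s) (forall_mem_image.2 hs)

theorem notMem_closure_biUnion (hP : IsPSpace X) {ι : Type*} {c : Set ι} (hc : c.Countable)
    {s : ι → Set X} {x : X} (hs : ∀ i ∈ c, x ∉ closure (s i)) :
    x ∉ closure (⋃ i ∈ c, s i) := by
  intro hx
  obtain ⟨y, hy, hys⟩ := mem_closure_iff.1 hx (⋂ i ∈ c, (closure (s i))ᶜ)
    (hP.isOpen_biInter_s14 hc fun i _ => isClosed_closure.isOpen_compl) (mem_iInter₂.2 hs)
  obtain ⟨i, hi, hyi⟩ := mem_iUnion₂.1 hys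
  exact mem_iInter₂.1 hy i hi (subset_closure hyi)

/-- In a Lindelöf Hausdorff P-space a closed set and a point outside it can be separated. -/
theorem exists_isOpen_superset_notMem_closure [T2Space X] [LindelofSpace X] (hP : IsPSpace X)
    {C : Set X} (hC : IsClosed C) {x : X} (hx : x ∉ C) :
    ∃ W, IsOpen W ∧ C ⊆ W ∧ x ∉ closure W := by
  have hsep : ∀ c, ∃ V : Set X, c ∈ C → IsOpen V ∧ c ∈ V ∧ x ∉ closure V := by
    intro c
    by_cases hc : c ∈ C
    · obtain ⟨U, V, hU, hV, hxU, hcV, hd⟩ := t2_separation (ne_of_mem_of_not_mem hc hx).symm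
      exact ⟨V, fun _ => ⟨hV, hcV, fun h => disjoint_left.1 (hd.closure_right hU) hxU h⟩⟩
    · exact ⟨∅, fun h => (hc h).elim⟩
  choose V hV using hsep
  obtain ⟨t, htc, htC, ht⟩ := hC.isLindelof.elim_nhds_subcover V fun c hc =>
    (hV c hc).1.mem_nhds (hV c hc).2.1
  exact ⟨⋃ c ∈ t, V c, isOpen_biUnion fun c hc => (hV c (htC c hc)).1, ht,
    hP.notMem_closure_biUnion htc fun c hc => (hV c (htC c hc)).2.2⟩

theorem isClosed_of_countable_s14 [T1Space X] (hP : IsPSpace X) {c : Set X} (hc : c.Countable) :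
    IsClosed c := by
  rw [← closure_subset_iff_isClosed]
  intro x hx
  by_contra hxc
  refine hP.notMem_closure_biUnion (s := fun y => {y}) hc (fun y hy => ?_) (by simpa using hx)
  rw [closure_singleton]
  rintro rfl
  exact hxc hy

/-- Every uncountable subset of a Lindelöf Hausdorff P-space contains an uncountable discrete
subset. -/
theorem exists_isDiscrete_not_countable [T2Space X] [LindelofSpace X] (hP : IsPSpace X)
    {B : Set X} (hB : ¬ B.Countable) : ∃ E ⊆ B, ¬ E.Countable ∧ IsDiscrete E := by
  obtain ⟨z, hz⟩ : ∃ z, ∀ U, IsOpen U → z ∈ U → ¬ (U ∩ B).Countable := by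
    by_contra! h
    choose U hU hzU hUB using h
    obtain ⟨c, hc, hcU⟩ := isLindelof_univ.elim_countable_subcover U hU
      fun z _ => mem_iUnion.2 ⟨z, hzU z⟩
    refine hB ((hc.biUnion fun z _ => hUB z).mono fun b hb => ?_)
    obtain ⟨z, hz, hbz⟩ := mem_iUnion₂.1 (hcU (mem_univ b))
    exact mem_iUnion₂.2 ⟨z, hz, hbz, hb⟩
  have hsep : ∀ b, ∃ U V : Set X, b ≠ z → IsOpen U ∧ IsOpen V ∧ z ∈ U ∧ b ∈ V ∧ Disjoint U V := by
    intro b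
    by_cases hb : b = z
    · exact ⟨∅, ∅, fun h => (h hb).elim⟩
    · obtain ⟨U, V, h⟩ := t2_separation (Ne.symm hb)
      exact ⟨U, V, fun _ => h⟩
  choose U V hUV using hsep
  obtain ⟨_, _⟩ := exists_wellFoundedLT X
  obtain ⟨E, hE⟩ := (wellFounded_lt (α := X)).exists_set_forall_mem_iff
    fun b T => b ∈ B ∧ b ≠ z ∧ T.Countable ∧ ∀ e ∈ T, b ∈ U e
  refine ⟨E, fun b hb => ((hE b).1 hb).1, fun hEc => ?_, ?_⟩
  · have hz' : ∀ e ∈ E, e ≠ z := fun e he => ((hE e).1 he).2.1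
    have hW := hz (⋂ e ∈ E, U e) (hP.isOpen_biInter_s14 hEc fun e he => (hUV e (hz' e he)).1)
      (mem_iInter₂.2 fun e he => (hUV e (hz' e he)).2.2.1)
    obtain ⟨b, ⟨hbU, hbB⟩, hbz⟩ : ∃ b ∈ (⋂ e ∈ E, U e) ∩ B, b ≠ z := by
      by_contra! h
      exact hW ((countable_singleton z).mono h)
    have hbU' := mem_iInter₂.1 hbU
    have hbE : b ∈ E := (hE b).2
      ⟨hbB, hbz, hEc.mono (sep_subset _ _), fun e he => hbU' e he.1⟩
    obtain ⟨_, _, _, hbV, hd⟩ := hUV b hbz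
    exact disjoint_left.1 hd (hbU' b hbE) hbV
  · rw [isDiscrete_iff_forall_mem_exists_isOpen]
    intro b hb
    obtain ⟨-, hbz, hc, hbU⟩ := (hE b).1 hb
    obtain ⟨-, hVo, -, hbV, hd⟩ := hUV b hbz
    refine ⟨(⋂ e ∈ {e ∈ E | e < b}, U e) ∩ V b, (hP.isOpen_biInter_s14 hc fun e he =>
      (hUV e ((hE e).1 he.1).2.1).1).inter hVo, ?_⟩
    ext e
    constructor
    · rintro ⟨⟨heU, heV⟩, he⟩
      rcases lt_trichotomy e b with h | h | h
      · obtain ⟨_, _, _, heV', hd'⟩ := hUV e ((hE e).1 he).2.1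
        exact (disjoint_left.1 hd' (mem_iInter₂.1 heU e ⟨he, h⟩) heV').elim
      · exact h
      · exact (disjoint_left.1 hd (((hE e).1 he).2.2.2 b ⟨hb, h⟩) heV).elim
    · rintro rfl
      exact ⟨⟨mem_iInter₂.2 hbU, hbV⟩, hb⟩

end IsPSpace

section Stratification

variable {X : Type*} [TopologicalSpace X] [T2Space X]

/-- A set accumulating at `x` contains a subset `S` accumulating at `x` that carries an upper
semicontinuous rank function, all of whose sublevel sets at ranks of points of `S` stay away
from `x`. -/
theorem exists_subset_mem_closure_rank [LinearOrder X] [WellFoundedLT X] {A : Set X} {x : X}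
    (hx : x ∈ closure A \ A) :
    ∃ S ⊆ A, x ∈ closure S ∧ ∃ (ρ : X → X) (O : X → Set X),
      (∀ s ∈ S, IsOpen (O s) ∧ s ∈ O s ∧ ∀ t ∈ S, t ∈ O s → ρ t ≤ ρ s) ∧
      ∀ s ∈ S, x ∉ closure {t ∈ S | ρ t ≤ ρ s} := by
  have hsep : ∀ b, ∃ V : Set X, IsOpen V ∧ x ∉ closure V ∧ (b ≠ x → b ∈ V) := by
    intro b
    by_cases hb : b = x
    · exact ⟨∅, isOpen_empty, by simp, fun h => (h hb).elim⟩
    · obtain ⟨U, V, hU, hV, hxU, hbV, hd⟩ := t2_separation (Ne.symm hb)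
      exact ⟨V, hV, fun h => disjoint_left.1 (hd.closure_right hU) hxU h, fun _ => hbV⟩
  choose V hV hxV hbV using hsep
  have hne : ∀ s, s ≠ x → {b | s ∈ V b}.Nonempty := fun s hs => ⟨s, hbV s hs⟩
  have hρ : ∀ s, ∃ b, s ≠ x → s ∈ V b ∧ ∀ c, s ∈ V c → b ≤ c := by
    intro s
    by_cases hs : s = x
    · exact ⟨s, fun h => (h hs).elim⟩
    · exact ⟨wellFounded_lt.min _ (hne s hs), fun _ => ⟨wellFounded_lt.min_mem _ (hne s hs),
        fun c hc => wellFounded_lt.min_le (s := {b | s ∈ V b}) hc⟩⟩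
  choose ρ hρ using hρ
  have hAx : ∀ s ∈ A, s ≠ x := by
    rintro s hs rfl
    exact hx.2 hs
  suffices ∃ S ⊆ A, x ∈ closure S ∧ ∀ s ∈ S, x ∉ closure {t ∈ S | ρ t ≤ ρ s} by
    obtain ⟨S, hSA, hxS, hS⟩ := this
    exact ⟨S, hSA, hxS, ρ, fun s => V (ρ s), fun s hs => ⟨hV _, (hρ s (hAx s (hSA hs))).1,
      fun t ht htV => (hρ t (hAx t (hSA ht))).2 _ htV⟩, hS⟩
  by_cases h : {a | x ∈ closure {t ∈ A | ρ t ≤ a}}.Nonempty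
  · set a := wellFounded_lt.min _ h
    have ha : x ∈ closure {t ∈ A | ρ t ≤ a} := wellFounded_lt.min_mem _ h
    refine ⟨{t ∈ A | ρ t < a}, sep_subset _ _, ?_, fun s hs hxs => ?_⟩
    · have hsub : {t ∈ A | ρ t ≤ a} ⊆ {t ∈ A | ρ t < a} ∪ V a := by
        rintro t ⟨ht, hta⟩
        rcases hta.lt_or_eq with h | h
        · exact Or.inl ⟨ht, h⟩
        · exact Or.inr (h ▸ (hρ t (hAx t ht)).1)
      have := closure_mono hsub ha
      rw [closure_union] at this
      exact this.resolve_right (hxV a)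
    · refine wellFounded_lt.not_lt_min {a | x ∈ closure {t ∈ A | ρ t ≤ a}} ?_ hs.2
      have hsub : {t ∈ {t ∈ A | ρ t < a} | ρ t ≤ ρ s} ⊆ {t ∈ A | ρ t ≤ ρ s} :=
        fun t ht => ⟨ht.1.1, ht.2⟩
      exact closure_mono hsub hxs
  · exact ⟨A, Subset.rfl, hx.1, fun s _ hs => h ⟨ρ s, hs⟩⟩

end Stratification

/-- In a Lindelöf Hausdorff Whyburn P-space almost closed sets witnessing the Whyburn property can
be chosen discrete. -/
theorem IsWhyburn.exists_isDiscrete {X : Type*} [TopologicalSpace X] [T2Space X] [LindelofSpace X]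
    (hX : IsWhyburn X) (hP : IsPSpace X) {A : Set X} {x : X} (hx : x ∈ closure A \ A) :
    ∃ D ⊆ A, IsDiscrete D ∧ closure D \ D = {x} := by
  have whyburn : ∀ B ⊆ A, x ∈ closure B → ∃ F ⊆ B, closure F \ F = {x} := fun B hBA hxB =>
    hX B (fun h => hx.2 (hBA (h.closure_subset hxB))) x ⟨hxB, fun h => hx.2 (hBA h)⟩
  suffices ∃ E ⊆ A, x ∈ closure E ∧ IsDiscrete E by
    obtain ⟨E, hEA, hxE, hE⟩ := this
    obtain ⟨D, hDE, hD⟩ := whyburn E hEA hxE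
    exact ⟨D, hDE.trans hEA, hE.mono hDE, hD⟩
  obtain ⟨_, _⟩ := exists_wellFoundedLT X
  obtain ⟨S, hSA, hxS, ρ, O, hO, hS⟩ := exists_subset_mem_closure_rank hx
  obtain ⟨F, hFS, hF⟩ := whyburn S hSA hxS
  have hxF : x ∈ closure F := (hF.ge rfl).1
  have hg : ∀ c, ∃ g, ∀ f ∈ F, ρ f = c → g ∈ F ∧ ρ g = c := by
    intro c
    by_cases h : ∃ f ∈ F, ρ f = c
    · obtain ⟨f, hf⟩ := h
      exact ⟨f, fun _ _ _ => hf⟩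
    · exact ⟨c, fun f hf hc => (h ⟨f, hf, hc⟩).elim⟩
  choose g hg using hg
  obtain ⟨E, hE⟩ := (InvImage.wf ρ wellFounded_lt).exists_set_forall_mem_iff
    fun f T => f ∈ F ∧ g (ρ f) = f ∧
      ∃ U, IsOpen U ∧ Disjoint U T ∧ ∀ f' ∈ F, ρ f ≤ ρ f' → f' ∈ U
  have hEF : E ⊆ F := fun f hf => ((hE f).1 hf).1
  refine ⟨E, hEF.trans (hFS.trans hSA), ?_, ?_⟩
  · by_contra hxE
    have hlind : IsLindelof (closure F ∩ closure E) :=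
      (isClosed_closure.inter isClosed_closure).isLindelof
    have hFE : ∀ y ∈ closure F ∩ closure E, y ∈ F := by
      rintro y ⟨hyF, hyE⟩
      by_contra hy
      have hyx : y = x := hF.le ⟨hyF, hy⟩
      exact hxE (hyx ▸ hyE)
    obtain ⟨t, htc, ht, htO⟩ := hlind.elim_nhds_subcover O fun y hy =>
      (hO y (hFS (hFE y hy))).1.mem_nhds (hO y (hFS (hFE y hy))).2.1
    have hQ : x ∉ closure (⋃ s ∈ t, {f ∈ S | ρ f ≤ ρ s}) :=
      hP.notMem_closure_biUnion htc fun s hs => hS s (hFS (hFE s (ht s hs)))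
    obtain ⟨f, hfF, hfQ⟩ : ∃ f ∈ F, f ∉ ⋃ s ∈ t, {f ∈ S | ρ f ≤ ρ s} := by
      by_contra! h
      exact hQ (closure_mono h hxF)
    have hlarge : ∀ f' ∈ F, ρ f ≤ ρ f' → f' ∈ (closure E)ᶜ := by
      intro f' hf' hle hf'E
      obtain ⟨s, hs, hf's⟩ := mem_iUnion₂.1 (htO ⟨subset_closure hf', hf'E⟩)
      exact hfQ (mem_iUnion₂.2 ⟨s, hs, hFS hfF, hle.trans
        ((hO s (hFS (hFE s (ht s hs)))).2.2 f' (hFS hf') hf's)⟩)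
    obtain ⟨hgF, hgρ⟩ := hg _ f hfF rfl
    refine hlarge _ hgF hgρ.ge (subset_closure ((hE _).2 ⟨hgF, by rw [hgρ], (closure E)ᶜ,
      isClosed_closure.isOpen_compl, ?_, by rwa [hgρ]⟩))
    exact disjoint_left.2 fun y hy hyE => hy (subset_closure hyE.1)
  · rw [isDiscrete_iff_forall_mem_exists_isOpen]
    intro f hf
    obtain ⟨hfF, hgf, U, hU, hUE, hfU⟩ := (hE f).1 hf
    obtain ⟨hOo, hfO, hOle⟩ := hO f (hFS hfF)
    refine ⟨U ∩ O f, hU.inter hOo, ?_⟩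
    ext e
    constructor
    · rintro ⟨⟨heU, heO⟩, he⟩
      rcases (hOle e (hFS (hEF he)) heO).lt_or_eq with h | h
      · exact (disjoint_left.1 hUE heU ⟨he, h⟩).elim
      · rw [mem_singleton_iff, ← ((hE e).1 he).2.1, h, hgf]
    · rintro rfl
      exact ⟨⟨hfU e hfF le_rfl, hfO⟩, hf⟩

/-- In a Lindelöf space a discrete almost closed set is almost contained in each neighbourhood of
its limit. -/
theorem IsDiscrete.countable_diff_of_closure_diff_eq {X : Type*} [TopologicalSpace X]
    [LindelofSpace X] {D U : Set X} {x : X} (hD : IsDiscrete D) (hx : closure D \ D = {x})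
    (hU : IsOpen U) (hxU : x ∈ U) : (D \ U).Countable := by
  have h : D \ U = closure D \ U := by
    refine (sdiff_subset_sdiff_left subset_closure).antisymm fun y hy => ⟨?_, hy.2⟩
    by_contra hyD
    have hyx : y = x := hx.le ⟨hy.1, hyD⟩
    exact hy.2 (hyx ▸ hxU)
  refine IsLindelof.countable_of_isDiscrete ?_ (hD.mono sdiff_subset)
  rw [h]
  exact (isClosed_closure.inter hU.isClosed_compl).isLindelof

theorem IsWhyburn.isWeaklyWhyburn {X : Type*} [TopologicalSpace X] (hX : IsWhyburn X) :
    IsWeaklyWhyburn X := by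
  intro A hA
  obtain ⟨x, hx⟩ : (closure A \ A).Nonempty :=
    sdiff_nonempty.2 fun h => hA (closure_subset_iff_isClosed.1 h)
  exact ⟨x, hx, hX A hA x hx⟩

theorem IsWeaklyWhyburn.exists_of_isClosedEmbedding {Y Z : Type*} [TopologicalSpace Y]
    [TopologicalSpace Z] (hY : IsWeaklyWhyburn Y) {f : Y → Z}
    (hf : Topology.IsClosedEmbedding f) {A : Set Z} (hA : ¬ IsClosed (f ⁻¹' A)) :
    ∃ z ∈ closure A \ A, ∃ F ⊆ A, closure F \ F = {z} := by
  obtain ⟨y, hy, F, hFA, hF⟩ := hY _ hA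
  refine ⟨f y, ⟨hf.continuous.closure_preimage_subset A hy.1, hy.2⟩, f '' F,
    image_subset_iff.2 hFA, ?_⟩
  rw [hf.closure_image_eq, ← image_sdiff hf.injective, hF, image_singleton]

/-- The product of a Hausdorff Lindelöf Whyburn P-space with a Hausdorff Lindelöf
weakly Whyburn P-space is weakly Whyburn. -/
theorem statement14 (X Y : Type*) [TopologicalSpace X] [TopologicalSpace Y]
    [T2Space X] [T2Space Y] [LindelofSpace X] [LindelofSpace Y]
    (hX : IsWhyburn X) (hXP : IsPSpace X)
    (hY : IsWeaklyWhyburn Y) (hYP : IsPSpace Y) :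
    IsWeaklyWhyburn (X × Y) := by
  intro A hA
  by_cases hvert : ∃ x, ¬ IsClosed {y | (x, y) ∈ A}
  · obtain ⟨x, hx⟩ := hvert
    refine hY.exists_of_isClosedEmbedding ⟨isEmbedding_prodMkRight x, ?_⟩ hx
    have : range (Prod.mk x : Y → X × Y) = Prod.fst ⁻¹' {x} := by
      ext ⟨a, b⟩
      simp [eq_comm]
    rw [this]
    exact isClosed_singleton.preimage continuous_fst
  by_cases hhor : ∃ y, ¬ IsClosed {x | (x, y) ∈ A}
  · obtain ⟨y, hy⟩ := hhor
    refine hX.isWeaklyWhyburn.exists_of_isClosedEmbedding ⟨isEmbedding_prodMkLeft y, ?_⟩ hy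
    have : range (fun x : X => (x, y)) = Prod.snd ⁻¹' {y} := by
      ext ⟨a, b⟩
      simp [eq_comm]
    rw [this]
    exact isClosed_singleton.preimage continuous_snd
  push Not at hvert hhor
  obtain ⟨⟨x₀, y₀⟩, hp, hpA⟩ : ∃ p ∈ closure A, p ∉ A := by
    by_contra! h
    exact hA (closure_subset_iff_isClosed.1 h)
  obtain ⟨W, hWo, hAW, hyW⟩ := hYP.exists_isOpen_superset_notMem_closure (hvert x₀) hpA
  set V : Set Y := (closure W)ᶜ
  have hVo : IsOpen V := isClosed_closure.isOpen_compl
  have hVA : ∀ y ∈ V, (x₀, y) ∉ A := fun y hy h => hy (subset_closure (hAW h))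
  have hx₀ : x₀ ∈ closure {x | ∃ y ∈ V, (x, y) ∈ A} \ {x | ∃ y ∈ V, (x, y) ∈ A} := by
    refine ⟨?_, fun ⟨y, hyV, hy⟩ => hVA y hyV hy⟩
    rw [mem_closure_iff]
    intro U hU hxU
    obtain ⟨⟨x, y⟩, ⟨hxU, hyV⟩, hxy⟩ := mem_closure_iff.1 hp (U ×ˢ V) (hU.prod hVo) ⟨hxU, hyW⟩
    exact ⟨x, hxU, y, hyV, hxy⟩
  obtain ⟨D, hDA, hD, hDx⟩ := hX.exists_isDiscrete hXP hx₀
  have hxD : x₀ ∈ closure D \ D := hDx.ge rfl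
  have hy : ∀ x, ∃ y, x ∈ D → y ∈ V ∧ (x, y) ∈ A := by
    intro x
    by_cases hx : x ∈ D
    · obtain ⟨y, hy⟩ := hDA hx
      exact ⟨y, fun _ => hy⟩
    · exact ⟨y₀, fun h => (hx h).elim⟩
  choose φ hφ using hy
  have hfib : ∀ v, {d ∈ D | φ d = v}.Countable := by
    intro v
    by_cases hv : (x₀, v) ∈ A
    · convert countable_empty
      rw [eq_empty_iff_forall_notMem]
      rintro d ⟨hd, rfl⟩
      exact hVA _ (hφ d hd).1 hv
    · refine (hD.countable_diff_of_closure_diff_eq hDx (hhor v).isOpen_compl hv).mono ?_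
      rintro d ⟨hd, rfl⟩
      exact ⟨hd, fun h => h (hφ d hd).2⟩
  have hpre : ∀ C : Set Y, C.Countable → {d ∈ D | φ d ∈ C}.Countable := by
    intro C hC
    refine (hC.biUnion fun v _ => hfib v).mono ?_
    rintro d ⟨hd, hdC⟩
    exact mem_iUnion₂.2 ⟨φ d, hdC, hd, rfl⟩
  have hB : ¬ (φ '' D).Countable := fun h => hxD.2 <| by
    refine (hXP.isClosed_of_countable_s14 ((hpre _ h).mono fun d hd => ?_)).closure_subset hxD.1
    exact ⟨hd, mem_image_of_mem φ hd⟩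
  obtain ⟨B, hBφ, hBc, hBd⟩ := hYP.exists_isDiscrete_not_countable hB
  obtain ⟨y, -, F, hFB, hF⟩ := hY B fun h => hBc (h.isLindelof.countable_of_isDiscrete hBd)
  have hFd : IsDiscrete F := hBd.mono hFB
  have hyF : y ∈ closure F \ F := hF.ge rfl
  have hD' : ¬ {d ∈ D | φ d ∈ F}.Countable := by
    intro h
    refine hyF.2 ((hYP.isClosed_of_countable_s14 ((h.image φ).mono fun v hv => ?_)).closure_subset
      hyF.1)
    obtain ⟨d, hd, rfl⟩ := hBφ (hFB hv)
    exact ⟨d, ⟨hd, hv⟩, rfl⟩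
  have hyA : (x₀, y) ∉ A := by
    intro hA
    obtain ⟨v, hvW, hvF⟩ := mem_closure_iff.1 hyF.1 W hWo (hAW hA)
    obtain ⟨d, hd, rfl⟩ := hBφ (hFB hvF)
    exact (hφ d hd).1 (subset_closure hvW)
  set G : Set (X × Y) := (fun d => (d, φ d)) '' {d ∈ D | φ d ∈ F}
  have hGA : G ⊆ A := by
    rintro _ ⟨d, hd, rfl⟩
    exact (hφ d hd.1).2
  have hyG : (x₀, y) ∈ closure G := by
    rw [mem_closure_iff]
    intro O hO hyO
    obtain ⟨U, U', hU, hU', hxU, hyU', hUO⟩ := isOpen_prod_iff.1 hO _ _ hyO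
    by_contra h
    refine hD' (((hD.countable_diff_of_closure_diff_eq hDx hU hxU).union
      (hpre _ (hFd.countable_diff_of_closure_diff_eq hF hU' hyU'))).mono ?_)
    intro d hd
    by_contra! hd'
    refine h ⟨(d, φ d), hUO ⟨?_, ?_⟩, d, hd, rfl⟩
    · by_contra hdU
      exact hd' (Or.inl ⟨hd.1, hdU⟩)
    · by_contra hdU'
      exact hd' (Or.inr ⟨hd.1, hd.2, hdU'⟩)
  refine ⟨(x₀, y), ⟨closure_mono hGA hyG, hyA⟩, G, hGA, Subset.antisymm ?_
    (singleton_subset_iff.2 ⟨hyG, fun h => hyA (hGA h)⟩)⟩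
  rintro ⟨a, v⟩ ⟨hav, havG⟩
  have haD : a ∈ closure D := by
    refine map_mem_closure continuous_fst hav ?_
    rintro _ ⟨d, hd, rfl⟩
    exact hd.1
  have hvF : v ∈ closure F := by
    refine map_mem_closure continuous_snd hav ?_
    rintro _ ⟨d, hd, rfl⟩
    exact hd.2
  have haD' : a ∉ D := by
    intro ha
    obtain ⟨U, hU, hUD⟩ := isDiscrete_iff_forall_mem_exists_isOpen.1 hD a ha
    have hGU : Prod.fst ⁻¹' U ∩ G ⊆ {(a, φ a)} := by
      rintro _ ⟨hdU, d, hd, rfl⟩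
      have hda : d = a := hUD.le ⟨hdU, hd.1⟩
      rw [hda]
      rfl
    have haU : a ∈ U := (hUD.ge rfl).1
    have hmem := (hU.preimage continuous_fst).inter_closure ⟨haU, hav⟩
    rw [((finite_singleton _).subset hGU).isClosed.closure_eq] at hmem
    exact havG hmem.2
  have hax : a = x₀ := hDx.le ⟨haD, haD'⟩
  subst hax
  have hvF' : v ∉ F := by
    intro hv
    obtain ⟨U, hU, hUF⟩ := isDiscrete_iff_forall_mem_exists_isOpen.1 hFd v hv
    have hvU : v ∈ U := (hUF.ge rfl).1
    have hmem := (hU.preimage continuous_snd).inter_closure ⟨hvU, hav⟩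
    refine hxD.2 ((hXP.isClosed_of_countable_s14 (hfib v)).closure_subset
      (map_mem_closure continuous_fst hmem ?_)).1
    rintro _ ⟨hdU, d, hd, rfl⟩
    exact ⟨hd.1, hUF.le ⟨hdU, hd.2⟩⟩
  have hvy : v = y := hF.le ⟨hvF, hvF'⟩
  rw [hvy]
  rfl
end
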